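/- T_{max,2}(25) = 123, T_{max,3}(25) = 151, and T_{max,4}(25) = 177; in particular, for l = 25 the function m1 ↦ T_{max,m1}(25) is strictly increasing on {1, 2, 3, 4}. -/

import Mathlib

open MvPolynomial

/-- A monomial ideal: an ideal containing the monomials of all its elements. -/
def IsMonomialIdeal (I : Ideal (MvPolynomial (Fin 3) ℂ)) : Prop :=
  ∀ p ∈ I, ∀ d ∈ p.support, (monomial d (1 : ℂ)) ∈ I

/-- Borel-fixed (strongly stable) in characteristic 0: for every monomial in `I`
divisible by `x_j`, and every `i < j`, replacing one factor `x_j` by `x_i`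
stays in `I`. -/
def IsBorelFixed (I : Ideal (MvPolynomial (Fin 3) ℂ)) : Prop :=
  ∀ d : Fin 3 →₀ ℕ, (monomial d (1 : ℂ)) ∈ I →
    ∀ i j : Fin 3, i < j → 0 < d j →
      (monomial (d + Finsupp.single i 1 - Finsupp.single j 1) (1 : ℂ)) ∈ I

/-- The dimension of the tangent space to the Hilbert scheme at `[I]`,
namely `dim_ℂ Hom_R(I, R/I)`. -/
noncomputable def tangentDim (I : Ideal (MvPolynomial (Fin 3) ℂ)) : ℕ :=
  Module.finrank ℂ (↥I →ₗ[MvPolynomial (Fin 3) ℂ] (MvPolynomial (Fin 3) ℂ ⧸ I))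

/-- `TmaxEq l m1 T` says that `T` is the maximum of `dim_ℂ Hom_R(I, R/I)` over all
Borel-fixed monomial ideals `I ⊆ ℂ[x,y,z]` of colength `l` whose smallest pure power
of `x` lying in `I` is `x^{m1}`. -/
def TmaxEq (l m1 T : ℕ) : Prop :=
  IsGreatest { t : ℕ | ∃ I : Ideal (MvPolynomial (Fin 3) ℂ),
      IsMonomialIdeal I ∧ IsBorelFixed I ∧
      Module.finrank ℂ (MvPolynomial (Fin 3) ℂ ⧸ I) = l ∧
      (X 0 : MvPolynomial (Fin 3) ℂ) ^ m1 ∈ I ∧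
      (X 0 : MvPolynomial (Fin 3) ℂ) ^ (m1 - 1) ∉ I ∧
      t = tangentDim I } T

/-- The exponent vector of `x ^ a * y ^ b * z ^ c`. -/
noncomputable def expo (a b c : ℕ) : Fin 3 →₀ ℕ := Finsupp.equivFunOnFinite.symm ![a, b, c]

@[simp] lemma expo_zero (a b c : ℕ) : expo a b c 0 = a := rfl
@[simp] lemma expo_one (a b c : ℕ) : expo a b c 1 = b := rfl
@[simp] lemma expo_two (a b c : ℕ) : expo a b c 2 = c := rfl

lemma expo_eta (d : Fin 3 →₀ ℕ) : expo (d 0) (d 1) (d 2) = d := by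
  ext i; fin_cases i <;> rfl

lemma expo_le_expo {a b c a' b' c' : ℕ} :
    expo a b c ≤ expo a' b' c' ↔ a ≤ a' ∧ b ≤ b' ∧ c ≤ c' := by
  simp [Finsupp.le_def, Fin.forall_fin_succ]

lemma expo_add_expo (a b c a' b' c' : ℕ) :
    expo a b c + expo a' b' c' = expo (a + a') (b + b') (c + c') := by
  ext i; fin_cases i <;> rfl

lemma expo_sub_expo (a b c a' b' c' : ℕ) :
    expo a b c - expo a' b' c' = expo (a - a') (b - b') (c - c') := by
  ext i; fin_cases i <;> rfl

lemma single_zero_eq_expo (n : ℕ) : Finsupp.single (0 : Fin 3) n = expo n 0 0 := by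
  ext i; fin_cases i <;> simp

lemma single_one_eq_expo (n : ℕ) : Finsupp.single (1 : Fin 3) n = expo 0 n 0 := by
  ext i; fin_cases i <;> simp

lemma single_two_eq_expo (n : ℕ) : Finsupp.single (2 : Fin 3) n = expo 0 0 n := by
  ext i; fin_cases i <;> simp

/-- The coefficient of a monomial outside a monomial ideal, as a functional on the quotient. -/
noncomputable def quotCoeff (I : Ideal (MvPolynomial (Fin 3) ℂ)) (d : Fin 3 →₀ ℕ) :
    (MvPolynomial (Fin 3) ℂ ⧸ I) →ₗ[ℂ] ℂ :=
  open Classical in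
  if h : I.restrictScalars ℂ ≤ LinearMap.ker (lcoeff ℂ d) then
    ((I.restrictScalars ℂ).liftQ (lcoeff ℂ d) h).comp
      (Submodule.Quotient.restrictScalarsEquiv ℂ I).symm.toLinearMap
  else 0

lemma IsMonomialIdeal.quotCoeff_mk {I : Ideal (MvPolynomial (Fin 3) ℂ)} (hI : IsMonomialIdeal I)
    {d : Fin 3 →₀ ℕ} (hd : monomial d (1 : ℂ) ∉ I) (f : MvPolynomial (Fin 3) ℂ) :
    quotCoeff I d (Ideal.Quotient.mk I f) = coeff d f := by
  have h : I.restrictScalars ℂ ≤ LinearMap.ker (lcoeff ℂ d) := by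
    intro p hp
    by_contra hne
    exact hd (hI p hp d (by simpa [mem_support_iff] using hne))
  rw [quotCoeff, dif_pos h]
  rfl

lemma IsMonomialIdeal.eq_zero_of_quotCoeff {I : Ideal (MvPolynomial (Fin 3) ℂ)}
    (hI : IsMonomialIdeal I) {q : MvPolynomial (Fin 3) ℂ ⧸ I}
    (h : ∀ d, monomial d (1 : ℂ) ∉ I → quotCoeff I d q = 0) : q = 0 := by
  obtain ⟨f, rfl⟩ := Ideal.Quotient.mk_surjective q
  rw [Ideal.Quotient.eq_zero_iff_mem, f.as_sum]
  refine Ideal.sum_mem _ fun d hd => ?_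
  by_cases hdI : monomial d (1 : ℂ) ∈ I
  · have := I.mul_mem_left (C (coeff d f)) hdI
    rwa [C_mul_monomial, mul_one] at this
  · have := h d hdI
    rw [hI.quotCoeff_mk hdI] at this
    exact absurd this (mem_support_iff.mp hd)

lemma monomial_mem_of_le {I : Ideal (MvPolynomial (Fin 3) ℂ)} {d e : Fin 3 →₀ ℕ} (h : d ≤ e)
    (hd : monomial d (1 : ℂ) ∈ I) : monomial e (1 : ℂ) ∈ I := by
  have := I.mul_mem_left (monomial (e - d) (1 : ℂ)) hd
  rwa [monomial_mul, tsub_add_cancel_of_le h, mul_one] at this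

lemma IsMonomialIdeal.quotCoeff_monomial_smul {I : Ideal (MvPolynomial (Fin 3) ℂ)}
    (hI : IsMonomialIdeal I) {d : Fin 3 →₀ ℕ} (hd : monomial d (1 : ℂ) ∉ I) (e : Fin 3 →₀ ℕ)
    (q : MvPolynomial (Fin 3) ℂ ⧸ I) :
    quotCoeff I d ((monomial e (1 : ℂ)) • q) = if e ≤ d then quotCoeff I (d - e) q else 0 := by
  obtain ⟨f, rfl⟩ := Ideal.Quotient.mk_surjective q
  have hs : (monomial e (1 : ℂ)) • Ideal.Quotient.mk I f
      = Ideal.Quotient.mk I (monomial e (1 : ℂ) * f) := rfl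
  rw [hs, hI.quotCoeff_mk hd, coeff_monomial_mul']
  split_ifs with h
  · rw [hI.quotCoeff_mk (fun h' => hd (monomial_mem_of_le tsub_le_self h')), one_mul]
  · rfl

/-- The classes of the monomials outside a monomial ideal form a basis of the quotient. -/
noncomputable def IsMonomialIdeal.quotBasis {I : Ideal (MvPolynomial (Fin 3) ℂ)}
    (hI : IsMonomialIdeal I) :
    Module.Basis {d : Fin 3 →₀ ℕ // monomial d (1 : ℂ) ∉ I} ℂ (MvPolynomial (Fin 3) ℂ ⧸ I) :=
  Module.Basis.mk (v := fun d => Ideal.Quotient.mk I (monomial d.1 (1 : ℂ)))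
    (by
      rw [linearIndependent_iff']
      intro s g hg d hd
      have h := congrArg (quotCoeff I d.1) hg
      simp only [map_sum, map_smul, map_zero, hI.quotCoeff_mk d.2, coeff_monomial,
        smul_eq_mul, mul_ite, mul_one, mul_zero] at h
      rw [Finset.sum_eq_single d] at h
      · simpa using h
      · intro e _ hne
        exact if_neg fun h' => hne (Subtype.ext h')
      · exact fun h' => absurd hd h')
    (by
      rintro q -
      obtain ⟨f, rfl⟩ := Ideal.Quotient.mk_surjective q
      rw [f.as_sum, map_sum]
      refine Submodule.sum_mem _ fun d _ => ?_
      have hc : Ideal.Quotient.mk I (monomial d (coeff d f))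
          = coeff d f • Ideal.Quotient.mk I (monomial d (1 : ℂ)) := by
        rw [← mul_one (coeff d f), ← smul_eq_mul, ← smul_monomial, smul_eq_mul, mul_one]; rfl
      rw [hc]
      refine Submodule.smul_mem _ _ ?_
      by_cases hdI : monomial d (1 : ℂ) ∈ I
      · rw [Ideal.Quotient.eq_zero_iff_mem.mpr hdI]; exact Submodule.zero_mem _
      · exact Submodule.subset_span ⟨⟨d, hdI⟩, rfl⟩)

/-- `I` is the monomial ideal whose monomials are the `x ^ a * y ^ b * z ^ c` with `H a b ≤ c`. -/
structure HasHeights (I : Ideal (MvPolynomial (Fin 3) ℂ)) (H : ℕ → ℕ → ℕ) : Prop where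
  isMonomial : IsMonomialIdeal I
  mem_iff : ∀ a b c, monomial (expo a b c) (1 : ℂ) ∈ I ↔ H a b ≤ c

namespace HasHeights

variable {I : Ideal (MvPolynomial (Fin 3) ℂ)} {H : ℕ → ℕ → ℕ}

lemma not_mem_iff (h : HasHeights I H) (a b c : ℕ) :
    monomial (expo a b c) (1 : ℂ) ∉ I ↔ c < H a b := by
  rw [h.mem_iff, not_le]

lemma finrank_quotient (h : HasHeights I H) {A B : ℕ}
    (hA : ∀ a b, A ≤ a → H a b = 0) (hB : ∀ a b, B ≤ b → H a b = 0) :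
    Module.finrank ℂ (MvPolynomial (Fin 3) ℂ ⧸ I)
      = ∑ a ∈ Finset.range A, ∑ b ∈ Finset.range B, H a b := by
  let s : Finset (Σ _ : ℕ, Σ _ : ℕ, ℕ) := (Finset.range A).sigma fun a =>
    (Finset.range B).sigma fun b => Finset.range (H a b)
  let e : {d : Fin 3 →₀ ℕ // monomial d (1 : ℂ) ∉ I} ≃ s :=
    { toFun := fun d => ⟨⟨d.1 0, d.1 1, d.1 2⟩, by
        have hd := d.2
        rw [← expo_eta d.1, h.not_mem_iff] at hd
        simp only [s, Finset.mem_sigma, Finset.mem_range]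
        refine ⟨?_, ?_, hd⟩
        · by_contra hle
          rw [hA _ _ (not_lt.mp hle)] at hd
          exact Nat.not_lt_zero _ hd
        · by_contra hle
          rw [hB _ _ (not_lt.mp hle)] at hd
          exact Nat.not_lt_zero _ hd⟩
      invFun := fun t => ⟨expo t.1.1 t.1.2.1 t.1.2.2, by
        have ht := t.2
        simp only [s, Finset.mem_sigma, Finset.mem_range] at ht
        exact (h.not_mem_iff _ _ _).mpr ht.2.2⟩
      left_inv := fun d => Subtype.ext (expo_eta d.1)
      right_inv := fun t => rfl }
  rw [Module.finrank_eq_nat_card_basis h.isMonomial.quotBasis, Nat.card_congr e,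
    Nat.card_eq_fintype_card, Fintype.card_coe, Finset.card_sigma]
  simp [Finset.card_sigma]

end HasHeights

/-- The height functions of Borel-fixed monomial ideals. -/
structure IsBorelStaircase (H : ℕ → ℕ → ℕ) : Prop where
  step_y : ∀ a b, H a (b + 1) ≤ H a b - 1
  step_x : ∀ a b, H (a + 1) b ≤ H a b - 1
  shift : ∀ a b, H (a + 1) b ≤ H a (b + 1)

lemma IsBorelFixed.isBorelStaircase {I : Ideal (MvPolynomial (Fin 3) ℂ)} {H : ℕ → ℕ → ℕ}
    (hB : IsBorelFixed I) (h : HasHeights I H) : IsBorelStaircase H where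
  step_y a b := by
    rcases Nat.eq_zero_or_pos (H a b) with h0 | h0
    · rw [h0, ← h.mem_iff]
      exact monomial_mem_of_le (expo_le_expo.mpr ⟨le_rfl, Nat.le_succ b, le_rfl⟩)
        ((h.mem_iff a b 0).mpr h0.le)
    · have := hB _ ((h.mem_iff a b _).mpr le_rfl) 1 2 (by decide) h0
      rw [single_one_eq_expo, single_two_eq_expo, expo_add_expo, expo_sub_expo, h.mem_iff] at this
      simpa using this
  step_x a b := by
    rcases Nat.eq_zero_or_pos (H a b) with h0 | h0
    · rw [h0, ← h.mem_iff]
      exact monomial_mem_of_le (expo_le_expo.mpr ⟨Nat.le_succ a, le_rfl, le_rfl⟩)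
        ((h.mem_iff a b 0).mpr h0.le)
    · have := hB _ ((h.mem_iff a b _).mpr le_rfl) 0 2 (by decide) h0
      rw [single_zero_eq_expo, single_two_eq_expo, expo_add_expo, expo_sub_expo, h.mem_iff] at this
      simpa using this
  shift a b := by
    have := hB _ ((h.mem_iff a (b + 1) _).mpr le_rfl) 0 1 (by decide) (Nat.succ_pos b)
    rw [single_zero_eq_expo, single_one_eq_expo, expo_add_expo, expo_sub_expo, h.mem_iff] at this
    simpa using this

namespace IsBorelStaircase

variable {H : ℕ → ℕ → ℕ}

lemma le_of_y (hH : IsBorelStaircase H) (a b : ℕ) : H a (b + 1) ≤ H a b :=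
  (hH.step_y a b).trans (Nat.sub_le _ _)

lemma le_of_x (hH : IsBorelStaircase H) (a b : ℕ) : H (a + 1) b ≤ H a b :=
  (hH.step_x a b).trans (Nat.sub_le _ _)

lemma antitone_x (hH : IsBorelStaircase H) (b : ℕ) : Antitone fun a => H a b :=
  antitone_nat_of_succ_le fun a => hH.le_of_x a b

lemma antitone_y (hH : IsBorelStaircase H) (a : ℕ) : Antitone (H a) :=
  antitone_nat_of_succ_le fun b => hH.le_of_y a b

lemma le_sub (hH : IsBorelStaircase H) (a b : ℕ) : H a b ≤ H a 0 - b := by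
  induction b with
  | zero => simp
  | succ b ih => have := hH.step_y a b; omega

lemma eq_zero_of_le (hH : IsBorelStaircase H) (a b : ℕ) (hb : H 0 0 ≤ b) : H a b = 0 := by
  have h1 := hH.le_sub a b
  have h2 : H a 0 ≤ H 0 0 := hH.antitone_x 0 (Nat.zero_le a)
  omega

lemma isBorelFixed (hH : IsBorelStaircase H) {I : Ideal (MvPolynomial (Fin 3) ℂ)}
    (h : HasHeights I H) : IsBorelFixed I := by
  intro d hd i j hij hj
  rw [← expo_eta d] at hd hj ⊢
  generalize d 0 = a at *
  generalize d 1 = b at *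
  generalize d 2 = c at *
  have hc := (h.mem_iff a b c).mp hd
  fin_cases i <;> fin_cases j <;> simp at hij hj ⊢
  · rw [single_zero_eq_expo, single_one_eq_expo, expo_add_expo, expo_sub_expo, h.mem_iff]
    obtain ⟨b, rfl⟩ := Nat.exists_eq_add_of_le' hj
    simpa using (hH.shift a b).trans hc
  · rw [single_zero_eq_expo, single_two_eq_expo, expo_add_expo, expo_sub_expo, h.mem_iff]
    have := hH.step_x a b
    simp; omega
  · rw [single_one_eq_expo, single_two_eq_expo, expo_add_expo, expo_sub_expo, h.mem_iff]
    have := hH.step_y a b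
    simp; omega

end IsBorelStaircase

lemma HasHeights.X_pow_mem_iff {I : Ideal (MvPolynomial (Fin 3) ℂ)} {H : ℕ → ℕ → ℕ}
    (h : HasHeights I H) (n : ℕ) : (X 0 : MvPolynomial (Fin 3) ℂ) ^ n ∈ I ↔ H n 0 = 0 := by
  rw [X_pow_eq_monomial, single_zero_eq_expo, h.mem_iff, Nat.le_zero]

lemma IsMonomialIdeal.exists_hasHeights {I : Ideal (MvPolynomial (Fin 3) ℂ)}
    (hI : IsMonomialIdeal I) (hfin : 0 < Module.finrank ℂ (MvPolynomial (Fin 3) ℂ ⧸ I)) :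
    ∃ H, HasHeights I H := by
  classical
  have := Module.finite_of_finrank_pos hfin
  have hf : Finite {d : Fin 3 →₀ ℕ // monomial d (1 : ℂ) ∉ I} :=
    Module.Finite.finite_basis hI.quotBasis
  have hex : ∀ a b, ∃ c, monomial (expo a b c) (1 : ℂ) ∈ I := by
    intro a b
    by_contra! hno
    refine not_injective_infinite_finite
      (fun c : ℕ => (⟨expo a b c, hno c⟩ : {d : Fin 3 →₀ ℕ // monomial d (1 : ℂ) ∉ I})) ?_
    intro c c' hcc
    simpa using congrArg (fun d => d.1 2) hcc
  refine ⟨fun a b => Nat.find (hex a b), hI, fun a b c =>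
    ⟨fun hm => Nat.find_min' _ hm, fun hle => ?_⟩⟩
  exact monomial_mem_of_le (expo_le_expo.mpr ⟨le_rfl, le_rfl, hle⟩) (Nat.find_spec (hex a b))

/-- The relations satisfied by the coefficients `F a b p q r` of `x ^ p * y ^ q * z ^ r` in the
images of the monomials `x ^ a * y ^ b * z ^ H a b` under a homomorphism `I → R ⧸ I`. -/
structure IsTangentFamily (H : ℕ → ℕ → ℕ) (F : ℕ → ℕ → ℕ → ℕ → ℕ → ℂ) : Prop where
  rel_x : ∀ a b p q r, r < H p q → (if p = 0 then 0 else F a b (p - 1) q r) =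
    if r < H a b - H (a + 1) b then 0 else F (a + 1) b p q (r - (H a b - H (a + 1) b))
  rel_y : ∀ a b p q r, r < H p q → (if q = 0 then 0 else F a b p (q - 1) r) =
    if r < H a b - H a (b + 1) then 0 else F a (b + 1) p q (r - (H a b - H a (b + 1)))

/-- The monomial `x ^ a * y ^ b * z ^ H a b` as an element of the ideal. -/
noncomputable def HasHeights.gen {I : Ideal (MvPolynomial (Fin 3) ℂ)} {H : ℕ → ℕ → ℕ}
    (h : HasHeights I H) (a b : ℕ) : I :=
  ⟨monomial (expo a b (H a b)) 1, (h.mem_iff a b _).mpr le_rfl⟩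

/-- The coefficients of the images of the monomials `x ^ a * y ^ b * z ^ H a b`. -/
noncomputable def HasHeights.homCoeff {I : Ideal (MvPolynomial (Fin 3) ℂ)} {H : ℕ → ℕ → ℕ}
    (h : HasHeights I H) (φ : I →ₗ[MvPolynomial (Fin 3) ℂ] (MvPolynomial (Fin 3) ℂ ⧸ I))
    (a b p q r : ℕ) : ℂ :=
  quotCoeff I (expo p q r) (φ (h.gen a b))

namespace HasHeights

variable {I : Ideal (MvPolynomial (Fin 3) ℂ)} {H : ℕ → ℕ → ℕ}

lemma isTangentFamily_homCoeff (h : HasHeights I H) (hH : IsBorelStaircase H)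
    (φ : I →ₗ[MvPolynomial (Fin 3) ℂ] (MvPolynomial (Fin 3) ℂ ⧸ I)) :
    IsTangentFamily H (h.homCoeff φ) where
  rel_x a b p q r hr := by
    have hmem := (h.not_mem_iff p q r).mpr hr
    have hg : monomial (expo 1 0 0) (1 : ℂ) • h.gen a b
        = monomial (expo 0 0 (H a b - H (a + 1) b)) (1 : ℂ) • h.gen (a + 1) b := by
      apply Subtype.ext
      simp only [gen, SetLike.mk_smul_mk, smul_eq_mul, monomial_mul, expo_add_expo, mul_one,
        zero_add, Nat.sub_add_cancel (hH.le_of_x a b), add_comm 1 a]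
    have := congrArg (fun t => quotCoeff I (expo p q r) (φ t)) hg
    simp only [map_smul, h.isMonomial.quotCoeff_monomial_smul hmem, expo_le_expo, zero_le,
      expo_sub_expo, tsub_zero, true_and, and_true] at this
    simpa only [homCoeff, ← not_lt, ite_not, Nat.lt_one_iff] using this
  rel_y a b p q r hr := by
    have hmem := (h.not_mem_iff p q r).mpr hr
    have hg : monomial (expo 0 1 0) (1 : ℂ) • h.gen a b
        = monomial (expo 0 0 (H a b - H a (b + 1))) (1 : ℂ) • h.gen a (b + 1) := by
      apply Subtype.ext
      simp only [gen, SetLike.mk_smul_mk, smul_eq_mul, monomial_mul, expo_add_expo, mul_one,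
        zero_add, Nat.sub_add_cancel (hH.le_of_y a b), add_comm 1 b]
    have := congrArg (fun t => quotCoeff I (expo p q r) (φ t)) hg
    simp only [map_smul, h.isMonomial.quotCoeff_monomial_smul hmem, expo_le_expo, zero_le,
      expo_sub_expo, tsub_zero, true_and, and_true] at this
    simpa only [homCoeff, ← not_lt, ite_not, Nat.lt_one_iff] using this

lemma hom_ext (h : HasHeights I H)
    {φ ψ : I →ₗ[MvPolynomial (Fin 3) ℂ] (MvPolynomial (Fin 3) ℂ ⧸ I)}
    (hφ : ∀ a b, φ (h.gen a b) = ψ (h.gen a b)) : φ = ψ := by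
  ext ⟨f, hf⟩
  have hsum : (⟨f, hf⟩ : I) = ∑ d ∈ f.support.attach, (monomial (d.1 - expo (d.1 0) (d.1 1)
      (H (d.1 0) (d.1 1))) (coeff d.1 f)) • h.gen (d.1 0) (d.1 1) := by
    apply Subtype.ext
    simp only [AddSubmonoidClass.coe_finsetSum, Submodule.coe_smul, gen, smul_eq_mul,
      monomial_mul, mul_one]
    conv_lhs => rw [f.as_sum, ← Finset.sum_attach]
    refine Finset.sum_congr rfl fun d _ => ?_
    have hd := h.isMonomial f hf d.1 d.2
    rw [← expo_eta d.1, h.mem_iff] at hd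
    rw [tsub_add_cancel_of_le]
    conv_rhs => rw [← expo_eta d.1]
    exact expo_le_expo.mpr ⟨le_rfl, le_rfl, hd⟩
  rw [hsum]
  simp only [map_sum, map_smul, hφ]

/-- The coefficients of a homomorphism at a finite set of positions. -/
noncomputable def evalHom (h : HasHeights I H) (P : Finset (ℕ × ℕ × ℕ × ℕ × ℕ)) :
    (I →ₗ[MvPolynomial (Fin 3) ℂ] (MvPolynomial (Fin 3) ℂ ⧸ I)) →ₗ[ℂ] (P → ℂ) where
  toFun φ t := h.homCoeff φ t.1.1 t.1.2.1 t.1.2.2.1 t.1.2.2.2.1 t.1.2.2.2.2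
  map_add' φ ψ := by ext t; simp [homCoeff]
  map_smul' c φ := by ext t; simp [homCoeff]

lemma evalHom_injective (h : HasHeights I H) (hH : IsBorelStaircase H)
    {P : Finset (ℕ × ℕ × ℕ × ℕ × ℕ)}
    (hP : ∀ F, IsTangentFamily H F → (∀ a b p q r, (a, b, p, q, r) ∈ P → F a b p q r = 0) →
      ∀ a b p q r, r < H p q → F a b p q r = 0) : Function.Injective (h.evalHom P) := by
  rw [injective_iff_map_eq_zero]
  intro φ hφ
  refine h.hom_ext fun a b => h.isMonomial.eq_zero_of_quotCoeff fun d hd => ?_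
  rw [← expo_eta d] at hd ⊢
  refine hP _ (h.isTangentFamily_homCoeff hH φ) (fun a b p q r ht => ?_) a b _ _ _
    ((h.not_mem_iff _ _ _).mp hd)
  exact congrFun hφ ⟨_, ht⟩

lemma tangentDim_le (h : HasHeights I H) (hH : IsBorelStaircase H)
    {P : Finset (ℕ × ℕ × ℕ × ℕ × ℕ)}
    (hP : ∀ F, IsTangentFamily H F → (∀ a b p q r, (a, b, p, q, r) ∈ P → F a b p q r = 0) →
      ∀ a b p q r, r < H p q → F a b p q r = 0) : tangentDim I ≤ P.card := by
  have := LinearMap.finrank_le_finrank_of_injective (h.evalHom_injective hH hP)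
  simpa [tangentDim] using this

end HasHeights

/-- The coefficients at the given position vanish for every homomorphism. -/
def Vanishes (H : ℕ → ℕ → ℕ) (a b p q s : ℕ) : Prop := ∀ F, IsTangentFamily H F → F a b p q s = 0

namespace Vanishes

variable {H : ℕ → ℕ → ℕ} {a b p q s : ℕ}

lemma of_left (hs : s + (H a b - H a (b + 1)) < H p 0) : Vanishes H a (b + 1) p 0 s := by
  intro F hF
  simpa using (hF.rel_y a b p 0 _ hs).symm

lemma of_down (hs : s + (H a b - H (a + 1) b) < H 0 q) : Vanishes H (a + 1) b 0 q s := by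
  intro F hF
  simpa using (hF.rel_x a b 0 q _ hs).symm

lemma of_right (hs : s < H p (q + 1)) (h : H a b - H a (b + 1) ≤ s →
    Vanishes H a (b + 1) p (q + 1) (s - (H a b - H a (b + 1)))) : Vanishes H a b p q s := by
  intro F hF
  have := hF.rel_y a b p (q + 1) s hs
  simp only [Nat.succ_ne_zero, if_false, Nat.add_sub_cancel] at this
  rw [this]
  split_ifs with h'
  · rfl
  · exact h (not_lt.mp h') F hF

lemma of_up (hs : s < H (p + 1) q) (h : H a b - H (a + 1) b ≤ s →
    Vanishes H (a + 1) b (p + 1) q (s - (H a b - H (a + 1) b))) : Vanishes H a b p q s := by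
  intro F hF
  have := hF.rel_x a b (p + 1) q s hs
  simp only [Nat.succ_ne_zero, if_false, Nat.add_sub_cancel] at this
  rw [this]
  split_ifs with h'
  · rfl
  · exact h (not_lt.mp h') F hF

end Vanishes

/-- The position is determined by earlier coefficients or contained in `P`. -/
def IsCovered (H : ℕ → ℕ → ℕ) (P : Finset (ℕ × ℕ × ℕ × ℕ × ℕ)) (a b p q s : ℕ) : Prop :=
  Vanishes H a b p q s ∨ (0 < b ∧ s + (H a (b - 1) - H a b) < H p q) ∨
    (0 < a ∧ s + (H (a - 1) b - H a b) < H p q) ∨ (a, b, p, q, s) ∈ P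

lemma IsTangentFamily.eq_left {H : ℕ → ℕ → ℕ} {F : ℕ → ℕ → ℕ → ℕ → ℕ → ℂ}
    (hF : IsTangentFamily H F) {a b p q r : ℕ} (hr : r + (H a b - H a (b + 1)) < H p (q + 1)) :
    F a (b + 1) p (q + 1) r = F a b p q (r + (H a b - H a (b + 1))) := by
  simpa using (hF.rel_y a b p (q + 1) _ hr).symm

lemma IsTangentFamily.eq_down {H : ℕ → ℕ → ℕ} {F : ℕ → ℕ → ℕ → ℕ → ℕ → ℂ}
    (hF : IsTangentFamily H F) {a b p q r : ℕ} (hr : r + (H a b - H (a + 1) b) < H (p + 1) q) :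
    F (a + 1) b (p + 1) q r = F a b p q (r + (H a b - H (a + 1) b)) := by
  simpa using (hF.rel_x a b (p + 1) q _ hr).symm

lemma IsTangentFamily.eq_zero_of_isCovered {H : ℕ → ℕ → ℕ} (hH : IsBorelStaircase H)
    {F : ℕ → ℕ → ℕ → ℕ → ℕ → ℂ}
    (hF : IsTangentFamily H F) {P : Finset (ℕ × ℕ × ℕ × ℕ × ℕ)}
    (hP : ∀ a b p q s, s < H p q → IsCovered H P a b p q s)
    (h0 : ∀ a b p q r, (a, b, p, q, r) ∈ P → F a b p q r = 0) :
    ∀ a b p q r, r < H p q → F a b p q r = 0 := by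
  suffices ∀ n a b, a + b = n → ∀ p q r, r < H p q → F a b p q r = 0 from
    fun a b => this _ a b rfl
  intro n
  induction n with
  | zero =>
    intro a b hab p q r hr
    rcases hP a b p q r hr with h | ⟨h, -⟩ | ⟨h, -⟩ | h
    · exact h F hF
    · omega
    · omega
    · exact h0 _ _ _ _ _ h
  | succ n ih =>
    intro a b hab p q r hr
    rcases hP a b p q r hr with h | ⟨h, h'⟩ | ⟨h, h'⟩ | h
    · exact h F hF
    · obtain _ | b := b
      · omega
      rw [Nat.add_sub_cancel] at h'
      obtain _ | q := q
      · exact Vanishes.of_left h' F hF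
      · rw [hF.eq_left h']
        exact ih a b (by omega) _ _ _ (h'.trans_le (hH.le_of_y p q))
    · obtain _ | a := a
      · omega
      rw [Nat.add_sub_cancel] at h'
      obtain _ | p := p
      · exact Vanishes.of_down h' F hF
      · rw [hF.eq_down h']
        exact ih a b (by omega) _ _ _ (h'.trans_le (hH.le_of_x p q))
    · exact h0 _ _ _ _ _ h

lemma HasHeights.tangentDim_le_of_isCovered {I : Ideal (MvPolynomial (Fin 3) ℂ)}
    {H : ℕ → ℕ → ℕ} (h : HasHeights I H) (hH : IsBorelStaircase H)
    {P : Finset (ℕ × ℕ × ℕ × ℕ × ℕ)}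
    (hP : ∀ a b p q s, s < H p q → IsCovered H P a b p q s) : tangentDim I ≤ P.card :=
  h.tangentDim_le hH fun _ hF h0 => hF.eq_zero_of_isCovered hH hP h0

lemma HasHeights.finite_hom_of_isCovered {I : Ideal (MvPolynomial (Fin 3) ℂ)}
    {H : ℕ → ℕ → ℕ} (h : HasHeights I H) (hH : IsBorelStaircase H)
    {P : Finset (ℕ × ℕ × ℕ × ℕ × ℕ)}
    (hP : ∀ a b p q s, s < H p q → IsCovered H P a b p q s) :
    Module.Finite ℂ (I →ₗ[MvPolynomial (Fin 3) ℂ] (MvPolynomial (Fin 3) ℂ ⧸ I)) :=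
  Module.Finite.of_injective (h.evalHom P) <|
    h.evalHom_injective hH fun _ hF h0 => hF.eq_zero_of_isCovered hH hP h0

/-! ### An efficient check over all tables of heights

The functions of this section are written with recursors and in continuation-passing style, and
natural numbers are evaluated with `force` before they are passed on, so that the kernel can run
them quickly. -/

/-- `k n`, with `n` evaluated to a literal first. -/
def force {α : Type} (n : ℕ) (k : ℕ → α) : α :=
  Nat.rec (k 0) (fun m _ => k (Nat.succ m)) n

/-- Whether `f` holds on all numbers at most `n`. -/
def forallLE (f : ℕ → Bool) (n : ℕ) : Bool :=
  Nat.rec (f 0) (fun m ih => cond (f (Nat.succ m)) ih false) n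

/-- The minimum, in terms of accelerated operations. -/
def natMin (x y : ℕ) : ℕ := Nat.sub x (Nat.sub x y)

/-- The maximum, in terms of accelerated operations. -/
def natMax (x y : ℕ) : ℕ := Nat.add x (Nat.sub y x)

/-- Whether `k r (n - r.sum)` holds for all rows `r` with `r.sum ≤ n` which strictly decrease to a
final zero, start with an entry at most `t`, and are bounded by `cs`. -/
def forallRows (cs : List ℕ) : ℕ → ℕ → (List ℕ → ℕ → Bool) → Bool :=
  List.rec (fun _ n k => k [0] n)
    (fun c _ ih t n k => forallLE (fun s => Nat.rec (k [0] n)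
      (fun s' _ => force (Nat.sub n (Nat.succ s')) fun m =>
        ih s' m fun r m' => k (Nat.succ s' :: r) m') s)
      (natMin (natMin c t) n)) cs

/-- The first number of a list, or zero. -/
def head0 (l : List ℕ) : ℕ := List.rec 0 (fun x _ _ => x) l

/-- The tail of a list. -/
def tail0 {α : Type} (l : List α) : List α := List.rec [] (fun _ x _ => x) l

/-- The first row of a table, or the empty row. -/
def headRow (l : List (List ℕ)) : List ℕ := List.rec [] (fun x _ _ => x) l

/-- The bounds which a row imposes on the next row of a Borel-fixed staircase. -/
def nextCaps (l : List ℕ) : List ℕ :=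
  List.rec [] (fun r rs ih => natMin (Nat.sub r 1) (head0 rs) :: ih) l

/-- Whether `k` holds for all tables of Borel-fixed staircases with `m` nonzero rows and total `n`
whose first row is bounded by the given list. -/
def forallTables (m : ℕ) : List ℕ → ℕ → (List (List ℕ) → Bool) → Bool :=
  Nat.rec (fun _ n k => cond (Nat.beq n 0) (k [[0]]) true)
    (fun _ ih caps n k => forallRows caps n n fun r n' =>
      cond (Nat.beq (head0 r) 0) true (ih (nextCaps r) n' fun T => k (r :: T))) m

/-- For a fixed generator and a row `hs` of columns, pass on the heights below which the
coefficients are known to vanish, and `n` increased by the number of free coefficients. Here `kR`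
and `kD` are the heights already computed for the two neighbouring generators. -/
def cellRow (dx dy ex ey dxT : ℕ) (hs : List ℕ) :
    ℕ → List ℕ → List ℕ → List ℕ → ℕ → (List ℕ → ℕ → Bool) → Bool :=
  List.rec (fun _ _ _ _ n k => k [] n)
    (fun h hs ih dyT hd kR kD n k =>
      force (natMax (natMax (Nat.sub h dyT) (Nat.sub h dxT))
          (natMax (natMin (head0 hs) (Nat.add ey (head0 kR)))
            (natMin (head0 hd) (Nat.add ex (head0 kD))))) fun t =>
      force (Nat.add n (natMin (Nat.sub h t) (natMin dx dy))) fun n' =>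
        ih 100 (tail0 hd) (tail0 kR) (tail0 kD) n' fun r n'' => k (t :: r) n'') hs

/-- The result of `cellRow` for all rows of columns. -/
def cellTable (dx dy ex ey : ℕ) (T : List (List ℕ)) :
    ℕ → List (List ℕ) → List (List ℕ) → ℕ → (List (List ℕ) → ℕ → Bool) → Bool :=
  List.rec (fun _ _ _ n k => k [] n)
    (fun hs T ih dxT kR kD n k =>
      cellRow dx dy ex ey dxT hs dy (headRow T) (tail0 (headRow kR)) (headRow kD) n fun r n' =>
        ih 100 (tail0 kR) (tail0 kD) n' fun R n'' => k (r :: R) n'') T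

/-- The first table of a list, or the empty table. -/
def headT (l : List (List (List ℕ))) : List (List ℕ) := List.rec [] (fun x _ _ => x) l

/-- The difference between `h` and the first number of a list, or zero. -/
def dropTo (h : ℕ) (l : List ℕ) : ℕ := List.rec 0 (fun d _ _ => Nat.sub h d) l

/-- The results of `cellTable` for a row of generators, from right to left. -/
def nodeRow (T : List (List ℕ)) (row : List ℕ) :
    ℕ → List ℕ → List ℕ → List (List (List ℕ)) → ℕ →
      (List (List (List ℕ)) → ℕ → Bool) → Bool :=
  List.rec (fun _ _ _ _ n k => k [] n)
    (fun h hs ih left up down K n k =>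
      ih h (tail0 up) (tail0 down) (tail0 K) n fun R n' =>
        force (Nat.sub left h) fun dy => force (Nat.sub (head0 up) h) fun dx =>
        force (dropTo h hs) fun ey =>
        force (dropTo h down) fun ex =>
        cellTable dx dy ex ey T dx (headT R) (tail0 (headT K)) n' fun r n'' => k (r :: R) n'') row

/-- The results of `nodeRow` for all rows of generators, starting from the last one. -/
def nodeTable (T : List (List ℕ)) (rows : List (List ℕ)) :
    List ℕ → ℕ → (List (List (List ℕ)) → ℕ → Bool) → Bool :=
  List.rec (fun _ n k => k [] n)
    (fun row rows ih up n k =>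
      ih row n fun K n' => nodeRow T row 100 up (headRow rows) K n' k) rows

/-- Whether the number of free coefficients found for the table `T` is at most `N`. -/
def tableCheck (N : ℕ) (T : List (List ℕ)) : Bool :=
  nodeTable T T (List.replicate 10 100) 0 fun _ n => Nat.ble n N

lemma force_eq {α : Type} (n : ℕ) (k : ℕ → α) : force n k = k n := by cases n <;> rfl

lemma natMin_eq (x y : ℕ) : natMin x y = min x y := by
  change x - (x - y) = _; omega

lemma natMax_eq (x y : ℕ) : natMax x y = max x y := by
  change x + (y - x) = _; omega

lemma head0_eq (l : List ℕ) : head0 l = l.getD 0 0 := by cases l <;> rfl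

lemma headRow_eq (l : List (List ℕ)) : headRow l = l.getD 0 [] := by cases l <;> rfl

lemma headT_eq (l : List (List (List ℕ))) : headT l = l.getD 0 [] := by cases l <;> rfl

lemma getD_tail0 {α : Type} (l : List α) (j : ℕ) (x : α) :
    (tail0 l).getD j x = l.getD (j + 1) x := by cases l <;> simp [tail0]

lemma length_tail0 {α : Type} (l : List α) : (tail0 l).length = l.length - 1 := by
  cases l <;> rfl

lemma cellRow_cons (dx dy ex ey dxT h : ℕ) (hs : List ℕ) (dyT : ℕ) (hd kR kD : List ℕ) (n : ℕ)
    (k : List ℕ → ℕ → Bool) : cellRow dx dy ex ey dxT (h :: hs) dyT hd kR kD n k =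
      let t := max (max (h - dyT) (h - dxT)) (max (min (hs.getD 0 0) (ey + kR.getD 0 0))
        (min (hd.getD 0 0) (ex + kD.getD 0 0)))
      cellRow dx dy ex ey dxT hs 100 (tail0 hd) (tail0 kR) (tail0 kD)
        (n + min (h - t) (min dx dy)) fun r n' => k (t :: r) n' := by
  have hcell : cellRow dx dy ex ey dxT (h :: hs) dyT hd kR kD n k =
      force (natMax (natMax (Nat.sub h dyT) (Nat.sub h dxT))
          (natMax (natMin (head0 hs) (Nat.add ey (head0 kR)))
            (natMin (head0 hd) (Nat.add ex (head0 kD))))) fun t =>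
        force (Nat.add n (natMin (Nat.sub h t) (natMin dx dy))) fun n' =>
          cellRow dx dy ex ey dxT hs 100 (tail0 hd) (tail0 kR) (tail0 kD) n' fun r n'' =>
            k (t :: r) n'' := rfl
  simp only [hcell, force_eq, natMin_eq, natMax_eq, head0_eq, Nat.add_eq, Nat.sub_eq]

lemma IsCovered.mono {H : ℕ → ℕ → ℕ} {P Q : Finset (ℕ × ℕ × ℕ × ℕ × ℕ)} {a b p q s : ℕ}
    (h : IsCovered H P a b p q s) (hPQ : P ⊆ Q) : IsCovered H Q a b p q s := by
  unfold IsCovered at *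
  exact h.imp_right (Or.imp_right (Or.imp_right fun h' => hPQ h'))

lemma cellRow_sound {H : ℕ → ℕ → ℕ} (h100 : ∀ p q, H p q ≤ 100) {a b p dx dy ex ey dxT : ℕ}
    (hdx : ∀ q s, s + dx < H p q → 0 < a ∧ s + (H (a - 1) b - H a b) < H p q)
    (hdy : ∀ q s, s + dy < H p q → 0 < b ∧ s + (H a (b - 1) - H a b) < H p q)
    (hdxT : ∀ q s, s + dxT < H p q → Vanishes H a b p q s)
    (hs : List ℕ) : ∀ (q dyT : ℕ) (hd kR kD : List ℕ) (n : ℕ) (k : List ℕ → ℕ → Bool),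
    (∀ j, hs.getD j 0 = H p (q + j)) → (∀ j, hd.getD j 0 = H (p + 1) (q + j)) →
    (∀ s, s + dyT < H p q → Vanishes H a b p q s) →
    (∀ j s, s < ey + kR.getD j 0 → s < H p (q + j + 1) → Vanishes H a b p (q + j) s) →
    (∀ j s, s < ex + kD.getD j 0 → s < H (p + 1) (q + j) → Vanishes H a b p (q + j) s) →
    cellRow dx dy ex ey dxT hs dyT hd kR kD n k = true →
    ∃ r n' P, k r n' = true ∧ n + P.card ≤ n' ∧
      (∀ j s, s < r.getD j 0 → Vanishes H a b p (q + j) s) ∧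
      ∀ j s, s < H p (q + j) → IsCovered H P a b p (q + j) s := by
  classical
  induction hs with
  | nil =>
    intro q dyT hd kR kD n k hhs _ _ _ _ hk
    refine ⟨[], n, ∅, hk, by simp, by simp, fun j s hj => ?_⟩
    rw [← hhs j] at hj
    simp at hj
  | cons h hs ih =>
    intro q dyT hd kR kD n k hhs hhd hdyT hR hD hk
    rw [cellRow_cons] at hk
    have e0 : h = H p q := by simpa using hhs 0
    have e1 : hs.getD 0 0 = H p (q + 1) := by simpa using hhs 1
    have e2 : hd.getD 0 0 = H (p + 1) q := by simpa using hhd 0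
    obtain ⟨r, n', P, hk', hn, hr, hP⟩ := ih (q + 1) 100 (tail0 hd) (tail0 kR) (tail0 kD) _ _
      (fun j => by simpa [add_assoc, add_comm 1 j] using hhs (j + 1))
      (fun j => by rw [getD_tail0, hhd, add_assoc, add_comm 1 j])
      (fun s hs' => absurd hs' (by have := h100 p (q + 1); omega))
      (fun j s h1 h2 => by
        rw [add_assoc q, add_comm 1 j] at h2 ⊢
        exact hR (j + 1) s (by rwa [getD_tail0] at h1) h2)
      (fun j s h1 h2 => by
        rw [add_assoc q, add_comm 1 j] at h2 ⊢
        exact hD (j + 1) s (by rwa [getD_tail0] at h1) h2) hk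
    rw [e0, e1, e2] at hk' hn
    generalize ht : max (max (H p q - dyT) (H p q - dxT))
      (max (min (H p (q + 1)) (ey + kR.getD 0 0))
        (min (H (p + 1) q) (ex + kD.getD 0 0))) = t at hk' hn
    have hV : ∀ s, s < t → Vanishes H a b p q s := by
      intro s hst
      rw [← ht] at hst
      simp only [lt_max_iff, lt_min_iff] at hst
      rcases hst with (h1 | h1) | ⟨h1, h2⟩ | ⟨h1, h2⟩
      · exact hdyT s (by omega)
      · exact hdxT q s (by omega)
      · exact hR 0 s h2 h1
      · exact hD 0 s h2 h1
    refine ⟨_, n', P ∪ (Finset.Ico (H p q - min (H p q - t) (min dx dy)) (H p q)).image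
      fun s => (a, b, p, q, s), hk', ?_, ?_, ?_⟩
    · have h1 := Finset.card_union_le P ((Finset.Ico (H p q - min (H p q - t) (min dx dy))
        (H p q)).image fun s => (a, b, p, q, s))
      have h2 : ((Finset.Ico (H p q - min (H p q - t) (min dx dy)) (H p q)).image
        fun s => (a, b, p, q, s)).card ≤ _ := Finset.card_image_le
      rw [Nat.card_Ico] at h2
      omega
    · intro j s hj
      obtain _ | j := j
      · exact hV s hj
      · rw [← add_assoc, add_right_comm]
        exact hr j s (by simpa using hj)
    · intro j s hj
      obtain _ | j := j
      · change s < H p q at hj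
        change IsCovered H _ a b p q s
        by_cases h1 : s < t
        · exact Or.inl (hV s h1)
        by_cases h2 : s + dy < H p q
        · exact Or.inr (Or.inl (hdy q s h2))
        by_cases h3 : s + dx < H p q
        · exact Or.inr (Or.inr (Or.inl (hdx q s h3)))
        · refine Or.inr (Or.inr (Or.inr (Finset.mem_union_right _
            (Finset.mem_image_of_mem _ ?_))))
          rw [Finset.mem_Ico]
          omega
      · rw [← add_assoc, add_right_comm] at hj ⊢
        exact (hP j s hj).mono Finset.subset_union_left

/-- The entry of a table of natural numbers, zero outside the table. -/
def entry (T : List (List ℕ)) (i j : ℕ) : ℕ := (T.getD i []).getD j 0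

lemma entry_tail0 (T : List (List ℕ)) (i j : ℕ) : entry (tail0 T) i j = entry T (i + 1) j := by
  rw [entry, getD_tail0, entry]

lemma entry_cons_succ (r : List ℕ) (T : List (List ℕ)) (i j : ℕ) :
    entry (r :: T) (i + 1) j = entry T i j := by simp [entry]

lemma cellTable_sound {H : ℕ → ℕ → ℕ} (h100 : ∀ p q, H p q ≤ 100) {a b dx dy ex ey : ℕ}
    (hdx : ∀ p q s, s + dx < H p q → 0 < a ∧ s + (H (a - 1) b - H a b) < H p q)
    (hdy : ∀ p q s, s + dy < H p q → 0 < b ∧ s + (H a (b - 1) - H a b) < H p q)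
    (T : List (List ℕ)) : ∀ (p dxT : ℕ) (kR kD : List (List ℕ)) (n : ℕ)
      (k : List (List ℕ) → ℕ → Bool),
    (∀ i j, entry T i j = H (p + i) j) →
    (∀ q s, s + dxT < H p q → Vanishes H a b p q s) →
    (∀ i j s, s < ey + entry kR i (j + 1) → s < H (p + i) (j + 1) → Vanishes H a b (p + i) j s) →
    (∀ i j s, s < ex + entry kD i j → s < H (p + i + 1) j → Vanishes H a b (p + i) j s) →
    cellTable dx dy ex ey T dxT kR kD n k = true →
    ∃ r n' P, k r n' = true ∧ n + P.card ≤ n' ∧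
      (∀ i j s, s < entry r i j → Vanishes H a b (p + i) j s) ∧
      ∀ i j s, s < H (p + i) j → IsCovered H P a b (p + i) j s := by
  classical
  induction T with
  | nil =>
    intro p dxT kR kD n k hT _ _ _ hk
    refine ⟨[], n, ∅, hk, by simp, by simp [entry], fun i j s hj => ?_⟩
    rw [← hT i j] at hj
    simp [entry] at hj
  | cons hs T ih =>
    intro p dxT kR kD n k hT hdxT hR hD hk
    change cellRow dx dy ex ey dxT hs dy (headRow T) (tail0 (headRow kR)) (headRow kD) n _ = true
      at hk
    rw [headRow_eq, headRow_eq, headRow_eq] at hk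
    obtain ⟨r, n₁, P, hk, hn, hr, hP⟩ := cellRow_sound h100 (hdx p) (hdy p) hdxT hs 0 _ _ _ _ _ _
      (fun j => by simpa [entry] using hT 0 j)
      (fun j => by simpa [entry] using hT 1 j)
      (fun s hs' => by
        obtain ⟨h1, h2⟩ := hdy p 0 s hs'
        obtain ⟨b, rfl⟩ := Nat.exists_eq_add_of_le' h1
        exact Vanishes.of_left h2)
      (fun j s h1 h2 => by
        rw [getD_tail0] at h1
        simp only [zero_add] at h2 ⊢
        exact hR 0 j s h1 h2)
      (fun j s h1 h2 => by
        simp only [zero_add] at h2 ⊢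
        exact hD 0 j s h1 h2) hk
    obtain ⟨R, n', Q, hk, hn', hr', hQ⟩ := ih (p + 1) 100 (tail0 kR) (tail0 kD) n₁ _
      (fun i j => by rw [← entry_cons_succ hs, hT, add_assoc, add_comm 1 i])
      (fun q s hs' => absurd hs' (by have := h100 (p + 1) q; omega))
      (fun i j s h1 h2 => by
        rw [add_assoc p, add_comm 1 i] at h2 ⊢
        exact hR (i + 1) j s (by rwa [entry_tail0] at h1) h2)
      (fun i j s h1 h2 => by
        rw [add_assoc p, add_comm 1 i] at h2 ⊢
        exact hD (i + 1) j s (by rwa [entry_tail0] at h1) h2) hk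
    refine ⟨_, n', P ∪ Q, hk, ?_, ?_, ?_⟩
    · have := Finset.card_union_le P Q
      omega
    · intro i j s hj
      obtain _ | i := i
      · simpa using hr j s (by simpa [entry] using hj)
      · rw [← add_assoc, add_right_comm]
        exact hr' i j s (by rwa [entry_cons_succ] at hj)
    · intro i j s hj
      obtain _ | i := i
      · have := hP j s (by simpa using hj)
        rw [zero_add] at this
        exact this.mono Finset.subset_union_left
      · rw [← add_assoc, add_right_comm] at hj ⊢
        exact (hQ i j s hj).mono Finset.subset_union_right

lemma nodeRow_cons (T : List (List ℕ)) (h : ℕ) (hs : List ℕ) (left : ℕ) (up down : List ℕ)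
    (K : List (List (List ℕ))) (n : ℕ) (k : List (List (List ℕ)) → ℕ → Bool) :
    nodeRow T (h :: hs) left up down K n k =
      nodeRow T hs h (tail0 up) (tail0 down) (tail0 K) n fun R n' =>
        cellTable (up.getD 0 0 - h) (left - h) (dropTo h down) (dropTo h hs) T (up.getD 0 0 - h)
          (R.getD 0 []) (tail0 (K.getD 0 [])) n' fun r n'' => k (r :: R) n'' := by
  have hnode : nodeRow T (h :: hs) left up down K n k =
      nodeRow T hs h (tail0 up) (tail0 down) (tail0 K) n fun R n' =>
        force (Nat.sub left h) fun dy => force (Nat.sub (head0 up) h) fun dx =>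
        force (dropTo h hs) fun ey => force (dropTo h down) fun ex =>
        cellTable dx dy ex ey T dx (headT R) (tail0 (headT K)) n' fun r n'' => k (r :: R) n'' := rfl
  simp only [hnode, force_eq, head0_eq, headT_eq, Nat.sub_eq]

lemma nodeRow_sound {H : ℕ → ℕ → ℕ} (h100 : ∀ p q, H p q ≤ 100) {T : List (List ℕ)}
    (hT : ∀ p q, entry T p q = H p q) {a : ℕ} (row : List ℕ) :
    ∀ (b left : ℕ) (up down : List ℕ) (K : List (List (List ℕ))) (n : ℕ)
      (k : List (List (List ℕ)) → ℕ → Bool),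
    (∀ j, row.getD j 0 = H a (b + j)) →
    (∀ p q s, s + (left - H a b) < H p q → 0 < b ∧ s + (H a (b - 1) - H a b) < H p q) →
    (∀ j < row.length, ∀ p q s, s + (up.getD j 0 - H a (b + j)) < H p q →
      0 < a ∧ s + (H (a - 1) (b + j) - H a (b + j)) < H p q) →
    (∀ j < down.length, down.getD j 0 = H (a + 1) (b + j)) →
    K.length ≤ down.length →
    (∀ j p q s, s < entry (K.getD j []) p q → Vanishes H (a + 1) (b + j) p q s) →
    nodeRow T row left up down K n k = true →
    ∃ R n' P, k R n' = true ∧ n + P.card ≤ n' ∧ R.length = row.length ∧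
      (∀ j p q s, s < entry (R.getD j []) p q → Vanishes H a (b + j) p q s) ∧
      ∀ j < row.length, ∀ p q s, s < H p q → IsCovered H P a (b + j) p q s := by
  classical
  induction row with
  | nil =>
    intro b left up down K n k _ _ _ _ _ _ hk
    exact ⟨[], n, ∅, hk, by simp, rfl, by simp [entry], by simp⟩
  | cons h hs ih =>
    intro b left up down K n k hrow hleft hup hdown hKl hK hk
    have e0 : h = H a b := by simpa using hrow 0
    rw [nodeRow_cons] at hk
    obtain ⟨R, n₁, P, hk, hn, hRl, hR, hP⟩ := ih (b + 1) h (tail0 up) (tail0 down) (tail0 K) _ _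
      (fun j => by simpa [add_assoc, add_comm 1 j] using hrow (j + 1))
      (fun p q s h1 => by rw [e0] at h1; exact ⟨Nat.succ_pos b, h1⟩)
      (fun j hj p q s h1 => by
        rw [getD_tail0] at h1
        rw [add_assoc b, add_comm 1 j] at h1 ⊢
        exact hup (j + 1) (by simpa using hj) p q s h1)
      (fun j hj => by
        rw [getD_tail0, add_assoc b, add_comm 1 j]
        rw [length_tail0] at hj
        exact hdown (j + 1) (by omega))
      (by simp only [length_tail0]; omega)
      (fun j p q s h1 => by
        rw [getD_tail0] at h1
        rw [add_assoc b, add_comm 1 j]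
        exact hK (j + 1) p q s h1) hk
    obtain ⟨r, n', Q, hk, hn', hr, hQ⟩ := cellTable_sound (a := a) (b := b) h100
      (fun p q s h1 => by rw [e0] at h1; exact hup 0 (by simp) p q s h1)
      (fun p q s h1 => by rw [e0] at h1; exact hleft p q s h1) T 0 _ _ _ _ _
      (fun i j => by rw [hT, zero_add])
      (fun q s h1 => by
        rw [e0] at h1
        obtain ⟨h2, h3⟩ := hup 0 (by simp) 0 q s h1
        obtain ⟨a, rfl⟩ := Nat.exists_eq_add_of_le' h2
        exact Vanishes.of_down h3)
      (fun i j s h1 h2 => by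
        rw [zero_add] at h2 ⊢
        cases hs with
        | nil =>
          rw [List.length_eq_zero_iff.mp hRl] at h1
          simp [dropTo, entry] at h1
        | cons d hs =>
          have e1 : d = H a (b + 1) := by simpa using hrow 1
          change s < h - d + _ at h1
          refine Vanishes.of_right h2 fun h3 => ?_
          refine hR 0 i (j + 1) _ ?_
          omega)
      (fun i j s h1 h2 => by
        rw [zero_add] at h2 ⊢
        rw [entry_tail0] at h1
        cases down with
        | nil =>
          rw [List.length_eq_zero_iff.mp (Nat.le_zero.mp hKl)] at h1
          simp [dropTo, entry] at h1
        | cons d hs =>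
          have e1 : d = H (a + 1) b := by simpa using hdown 0 (by simp)
          change s < h - d + _ at h1
          refine Vanishes.of_up h2 fun h3 => ?_
          refine hK 0 (i + 1) j _ ?_
          omega) hk
    refine ⟨_, n', P ∪ Q, hk, ?_, by simp [hRl], ?_, ?_⟩
    · have := Finset.card_union_le P Q
      omega
    · intro j p q s hj
      obtain _ | j := j
      · simpa using hr p q s (by simpa using hj)
      · rw [← add_assoc, add_right_comm]
        exact hR j p q s (by simpa using hj)
    · intro j hj p q s hs'
      obtain _ | j := j
      · have := hQ p q s (by simpa using hs')
        rw [zero_add] at this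
        exact this.mono Finset.subset_union_right
      · rw [← add_assoc, add_right_comm]
        exact (hP j (by simpa using hj) p q s hs').mono Finset.subset_union_left

lemma nodeTable_sound {H : ℕ → ℕ → ℕ} (h50 : ∀ p q, H p q ≤ 50) {T : List (List ℕ)}
    (hT : ∀ p q, entry T p q = H p q) (rows : List (List ℕ)) :
    ∀ (a : ℕ) (up : List ℕ) (n : ℕ) (k : List (List (List ℕ)) → ℕ → Bool),
    (∀ i j, entry rows i j = H (a + i) j) →
    (∀ j < (rows.getD 0 []).length, ∀ p q s, s + (up.getD j 0 - H a j) < H p q →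
      0 < a ∧ s + (H (a - 1) j - H a j) < H p q) →
    nodeTable T rows up n k = true →
    ∃ R n' P, k R n' = true ∧ n + P.card ≤ n' ∧ R.length = (rows.getD 0 []).length ∧
      (∀ j p q s, s < entry (R.getD j []) p q → Vanishes H a j p q s) ∧
      ∀ i, ∀ j < (rows.getD i []).length, ∀ p q s, s < H p q →
        IsCovered H P (a + i) j p q s := by
  classical
  induction rows with
  | nil =>
    intro a up n k _ _ hk
    exact ⟨[], n, ∅, hk, by simp, rfl, by simp [entry], by simp⟩
  | cons row rows ih =>
    intro a up n k hrows hup hk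
    change nodeTable T rows row n (fun K n' => nodeRow T row 100 up (headRow rows) K n' k) = true
      at hk
    rw [headRow_eq] at hk
    have hrow : ∀ j, row.getD j 0 = H a j := fun j => by simpa [entry] using hrows 0 j
    have hdown : ∀ j, (rows.getD 0 []).getD j 0 = H (a + 1) j := fun j => by
      simpa [entry] using hrows 1 j
    obtain ⟨K, n₁, P, hk, hn, hKl, hK, hP⟩ := ih (a + 1) row n _
      (fun i j => by rw [← entry_cons_succ row, hrows, add_assoc, add_comm 1 i])
      (fun j _ p q s h1 => by rw [hrow] at h1; exact ⟨Nat.succ_pos a, h1⟩) hk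
    obtain ⟨R, n', Q, hk, hn', hRl, hR, hQ⟩ := nodeRow_sound
      (fun p q => (h50 p q).trans (by norm_num)) hT (a := a) row 0 100 up
      (rows.getD 0 []) K n₁ k (by simpa using hrow)
      (fun p q s h1 => absurd h1 (by
        have := h50 a 0
        have := h50 p q
        omega))
      (by simpa using hup) (by simpa using fun j _ => hdown j) hKl.le (by simpa using hK) hk
    refine ⟨R, n', P ∪ Q, hk, ?_, by simpa using hRl, by simpa using hR, ?_⟩
    · have := Finset.card_union_le P Q
      omega
    · intro i j hj p q s hs
      obtain _ | i := i
      · simpa using (hQ j (by simpa using hj) p q s hs).mono Finset.subset_union_right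
      · rw [← add_assoc, add_right_comm]
        exact (hP i j (by simpa using hj) p q s hs).mono Finset.subset_union_left

/-- `T` lists the values of the height function `H`, every row ending in a zero. -/
structure IsTableOf (T : List (List ℕ)) (H : ℕ → ℕ → ℕ) : Prop where
  entry_eq : ∀ a b, entry T a b = H a b
  length_pos : 0 < T.length
  eq_zero_of_length_le : ∀ a b, T.length ≤ a + 1 → H a b = 0
  row_eq_zero : ∀ a < T.length, ∀ b, (T.getD a []).length ≤ b → 0 < b ∧ H a (b - 1) = 0

lemma tableCheck_sound {H : ℕ → ℕ → ℕ} (h50 : ∀ p q, H p q ≤ 50)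
    {T : List (List ℕ)} (hT : IsTableOf T H) (hlen : (T.getD 0 []).length ≤ 10) {N : ℕ}
    (hN : tableCheck N T = true) :
    ∃ P : Finset (ℕ × ℕ × ℕ × ℕ × ℕ), P.card ≤ N ∧
      ∀ a b p q s, s < H p q → IsCovered H P a b p q s := by
  obtain ⟨R, n, P, hk, hn, -, -, hP⟩ := nodeTable_sound h50 hT.entry_eq T 0
    (List.replicate 10 100) 0 _ (by simpa using hT.entry_eq)
    (fun j hj p q s h1 => absurd h1 (by
      rw [List.getD_replicate _ (hj.trans_le hlen)]
      have := h50 0 j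
      have := h50 p q
      omega)) hN
  refine ⟨P, (by omega : P.card ≤ n).trans (Nat.le_of_ble_eq_true hk), fun a b p q s hs => ?_⟩
  by_cases ha : a < T.length
  · by_cases hb : b < (T.getD a []).length
    · simpa using hP a b hb p q s hs
    · obtain ⟨h1, h2⟩ := hT.row_eq_zero a ha b (not_lt.mp hb)
      exact Or.inr (Or.inl ⟨h1, by omega⟩)
  · have h1 := hT.length_pos
    have h2 := hT.eq_zero_of_length_le (a - 1) b (by omega)
    exact Or.inr (Or.inr (Or.inl ⟨by omega, by omega⟩))

lemma of_forallLE {f : ℕ → Bool} {n : ℕ} (h : forallLE f n = true) : ∀ j ≤ n, f j = true := by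
  induction n with
  | zero =>
    intro j hj
    rw [Nat.le_zero.mp hj]
    exact h
  | succ n ih =>
    change cond (f (n + 1)) (forallLE f n) false = true at h
    cases hf : f (n + 1)
    · simp [hf] at h
    · intro j hj
      rcases Nat.le_succ_iff.mp hj with hj | rfl
      · exact ih (by simpa [hf] using h) j hj
      · exact hf

lemma forallRows_sound (cs : List ℕ) : ∀ (g : ℕ → ℕ) (M t n : ℕ) (k : List ℕ → ℕ → Bool),
    (∀ j, g (j + 1) ≤ g j - 1) → (∀ j, M ≤ j → g j = 0) → (∀ j, g j ≤ cs.getD j 0) → g 0 ≤ t →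
    ∑ j ∈ Finset.range M, g j ≤ n → forallRows cs t n k = true →
    ∃ r, k r (n - ∑ j ∈ Finset.range M, g j) = true ∧ r.length ≤ cs.length + 1 ∧
      (∀ j, r.getD j 0 = g j) ∧ ∀ b, r.length ≤ b → 0 < b ∧ g (b - 1) = 0 := by
  have hzero : ∀ (g : ℕ → ℕ) (M n : ℕ) (k : List ℕ → ℕ → Bool) (l : ℕ), (∀ j, g j = 0) →
      k [0] n = true → ∃ r, k r (n - ∑ j ∈ Finset.range M, g j) = true ∧ r.length ≤ l + 1 ∧
      (∀ j, r.getD j 0 = g j) ∧ ∀ b, r.length ≤ b → 0 < b ∧ g (b - 1) = 0 := by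
    intro g M n k l hg hk
    refine ⟨[0], by simpa [hg] using hk, by simp, fun j => ?_, fun b hb => ⟨hb, hg _⟩⟩
    cases j <;> simp [hg]
  induction cs with
  | nil =>
    intro g M t n k _ _ hcs _ _ hk
    exact hzero g M n k 0 (by simpa using hcs) hk
  | cons c cs ih =>
    intro g M t n k hg hM hcs ht hn hk
    have h0 : g 0 ≤ n := by
      cases M with
      | zero => simp [hM 0 le_rfl]
      | succ M => exact (Finset.single_le_sum (fun _ _ => Nat.zero_le _) (by simp)).trans hn
    have hc : g 0 ≤ c := by simpa using hcs 0
    have hk := of_forallLE hk (g 0) (by rw [natMin_eq, natMin_eq]; omega)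
    obtain hs | ⟨s, hs⟩ : g 0 = 0 ∨ ∃ s, g 0 = s + 1 := by
      cases h : g 0 <;> simp
    · rw [hs] at hk
      refine hzero g M n k _ (fun j => ?_) hk
      have : g j ≤ g 0 := antitone_nat_of_succ_le
        (fun j => (hg j).trans (Nat.sub_le _ _)) (Nat.zero_le j)
      omega
    · rw [hs] at hk
      change force (n - (s + 1)) (fun m => forallRows cs s m fun r m' => k ((s + 1) :: r) m')
        = true at hk
      rw [force_eq] at hk
      have hsum : ∑ j ∈ Finset.range M, g j = ∑ j ∈ Finset.range M, g (j + 1) + (s + 1) := by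
        rw [← hs, ← Finset.sum_range_succ', Finset.sum_range_succ, hM M le_rfl, add_zero]
      obtain ⟨r, hr, hrl, hrg, hrz⟩ := ih (fun j => g (j + 1)) M s (n - (s + 1)) _
        (fun j => hg (j + 1)) (fun j hj => hM _ (by omega)) (fun j => by simpa using hcs (j + 1))
        (by have h1 : g 1 ≤ g 0 - 1 := hg 0; change g 1 ≤ s; omega) (by omega) hk
      refine ⟨(s + 1) :: r, ?_, by simpa using hrl, fun j => ?_, fun b hb => ?_⟩
      · rwa [hsum, Nat.add_comm _ (s + 1), ← Nat.sub_sub]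
      · cases j with
        | zero => simp [hs]
        | succ j => simpa using hrg j
      · obtain ⟨h1, h2⟩ := hrz (b - 1) (by simp at hb; omega)
        refine ⟨by omega, ?_⟩
        rwa [Nat.sub_add_cancel h1] at h2

lemma getD_nextCaps (r : List ℕ) (j : ℕ) :
    (nextCaps r).getD j 0 = min (r.getD j 0 - 1) (r.getD (j + 1) 0) := by
  induction r generalizing j with
  | nil => simp [nextCaps]
  | cons h r ih =>
    change (natMin (h - 1) (head0 r) :: nextCaps r).getD j 0 = _
    cases j with
    | zero => simp [natMin_eq, head0_eq]
    | succ j => simpa using ih j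

lemma forallTables_sound (m : ℕ) : ∀ (H : ℕ → ℕ → ℕ) (M : ℕ) (caps : List ℕ) (n : ℕ)
    (k : List (List ℕ) → Bool), IsBorelStaircase H → (∀ a b, m ≤ a → H a b = 0) →
    (∀ a b, M ≤ b → H a b = 0) → (∀ a < m, 0 < H a 0) → (∀ b, H 0 b ≤ caps.getD b 0) →
    ∑ a ∈ Finset.range m, ∑ b ∈ Finset.range M, H a b = n → forallTables m caps n k = true →
    ∃ T, k T = true ∧ IsTableOf T H ∧ (T.getD 0 []).length ≤ caps.length + 1 ∧
      T.length = m + 1 := by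
  induction m with
  | zero =>
    intro H M caps n k _ hm _ _ _ hn hk
    have hz : ∀ a b, H a b = 0 := fun a b => hm a b (Nat.zero_le a)
    rw [Finset.sum_range_zero] at hn
    subst hn
    refine ⟨[[0]], hk, ⟨fun a b => ?_, by simp, fun a b _ => hz a b, fun a ha b hb => ⟨?_, hz _ _⟩⟩,
      by simp, rfl⟩
    · rw [hz]
      rcases a with _ | a <;> rcases b with _ | b <;> simp [entry]
    · simp at ha
      subst ha
      exact hb
  | succ m ih =>
    intro H M caps n k hH hm hM hpos hcaps hn hk
    change forallRows caps n n (fun r n' => cond (Nat.beq (head0 r) 0) true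
      (forallTables m (nextCaps r) n' fun T => k (r :: T))) = true at hk
    rw [Finset.sum_range_succ'] at hn
    have h0 : H 0 0 ≤ ∑ b ∈ Finset.range M, H 0 b := by
      cases M with
      | zero => simp [hM 0 0 le_rfl]
      | succ M =>
        exact Finset.single_le_sum (f := fun b => H 0 b) (fun _ _ => Nat.zero_le _) (by simp)
    obtain ⟨r, hr, hrl, hrg, hrz⟩ := forallRows_sound caps (H 0) M n n _ (hH.step_y 0) (hM 0) hcaps
      (by omega) (by omega) hk
    have hne : Nat.beq (head0 r) 0 = false := by
      rw [head0_eq, hrg]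
      cases h : H 0 0 with
      | zero => exact absurd h (hpos 0 (Nat.succ_pos m)).ne'
      | succ => rfl
    rw [hne, cond_false] at hr
    obtain ⟨T, hT, hTH, -, hTl⟩ := ih (fun a => H (a + 1)) M (nextCaps r) _ _
      ⟨fun a => hH.step_y (a + 1), fun a => hH.step_x (a + 1), fun a => hH.shift (a + 1)⟩
      (fun a b ha => hm _ _ (by omega)) (fun a b hb => hM _ _ hb)
      (fun a ha => hpos _ (by omega))
      (fun b => by
        rw [getD_nextCaps, hrg, hrg]
        exact le_min (hH.step_x 0 b) (hH.shift 0 b))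
      (by omega) hr
    refine ⟨r :: T, hT, ⟨fun a b => ?_, by simp, fun a b ha => hm a b (by simp at ha; omega),
      fun a ha b hb => ?_⟩, by simpa using hrl, by simp [hTl]⟩
    · cases a with
      | zero => simpa [entry] using hrg b
      | succ a => rw [entry_cons_succ]; exact hTH.entry_eq a b
    · cases a with
      | zero => exact hrz b (by simpa using hb)
      | succ a => exact hTH.row_eq_zero a (by simpa using ha) b (by simpa using hb)

lemma exists_isCovered_of_forallTables {I : Ideal (MvPolynomial (Fin 3) ℂ)} {m N : ℕ} (hm : 0 < m)
    (hcheck : forallTables m (List.replicate 7 25) 25 (tableCheck N) = true)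
    (hI : IsMonomialIdeal I) (hB : IsBorelFixed I)
    (hfin : Module.finrank ℂ (MvPolynomial (Fin 3) ℂ ⧸ I) = 25)
    (hmem : (X 0 : MvPolynomial (Fin 3) ℂ) ^ m ∈ I)
    (hnot : (X 0 : MvPolynomial (Fin 3) ℂ) ^ (m - 1) ∉ I) :
    ∃ H P, HasHeights I H ∧ IsBorelStaircase H ∧ P.card ≤ N ∧
      ∀ a b p q s, s < H p q → IsCovered H P a b p q s := by
  obtain ⟨H, h⟩ := hI.exists_hasHeights (by omega)
  have hH := hB.isBorelStaircase h
  rw [h.X_pow_mem_iff] at hmem hnot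
  have hA : ∀ a b, m ≤ a → H a b = 0 := fun a b ha => by
    have h1 : H a 0 ≤ H m 0 := hH.antitone_x 0 ha
    have h2 := hH.le_sub a b
    omega
  have hsum := h.finrank_quotient hA hH.eq_zero_of_le
  rw [hfin] at hsum
  have hrow : ∑ b ∈ Finset.range (H 0 0), H 0 b ≤ 25 := by
    rw [hsum]
    exact Finset.single_le_sum (f := fun a => ∑ b ∈ Finset.range (H 0 0), H a b)
      (fun _ _ => Nat.zero_le _) (Finset.mem_range.mpr hm)
  have hlt : H 0 7 = 0 := by
    by_contra h7
    have e : ∀ j, H 0 (j + 1) ≤ H 0 j - 1 := hH.step_y 0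
    have e0 := e 0; have e1 := e 1; have e2 := e 2; have e3 := e 3
    have e4 := e 4; have e5 := e 5; have e6 := e 6
    norm_num at e0 e1 e2 e3 e4 e5 e6
    have hle : ∑ b ∈ Finset.range 8, H 0 b ≤ 25 :=
      (Finset.sum_le_sum_of_subset (Finset.range_mono (by omega))).trans hrow
    simp only [Finset.sum_range_succ, Finset.sum_range_zero] at hle
    omega
  have h25 : ∀ p q, H p q ≤ 25 := fun p q => by
    have h1 := hH.le_sub p q
    have h2 : H p 0 ≤ H 0 0 := hH.antitone_x 0 (Nat.zero_le p)
    have h3 : H 0 0 ≤ 25 := by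
      rcases Nat.eq_zero_or_pos (H 0 0) with h0 | h0
      · omega
      · exact (Finset.single_le_sum (f := fun b => H 0 b) (fun _ _ => Nat.zero_le _)
          (Finset.mem_range.mpr h0)).trans hrow
    omega
  obtain ⟨T, hk, hT, hlen, -⟩ := forallTables_sound m H (H 0 0) _ 25 _ hH hA hH.eq_zero_of_le
    (fun a ha => (Nat.pos_of_ne_zero hnot).trans_le (hH.antitone_x 0 (by omega)))
    (fun b => by
      by_cases hb : b < 7
      · rw [List.getD_replicate _ hb]
        exact h25 0 b
      · have : H 0 b ≤ H 0 7 := hH.antitone_y 0 (not_lt.mp hb)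
        omega) hsum.symm hcheck
  obtain ⟨P, hP, hcov⟩ := tableCheck_sound (fun p q => (h25 p q).trans (by norm_num)) hT
    (hlen.trans (by simp)) hk
  exact ⟨H, P, h, hH, hP, hcov⟩

lemma tangentDim_le_of_forallTables {I : Ideal (MvPolynomial (Fin 3) ℂ)} {m N : ℕ} (hm : 0 < m)
    (hcheck : forallTables m (List.replicate 7 25) 25 (tableCheck N) = true)
    (hI : IsMonomialIdeal I) (hB : IsBorelFixed I)
    (hfin : Module.finrank ℂ (MvPolynomial (Fin 3) ℂ ⧸ I) = 25)
    (hmem : (X 0 : MvPolynomial (Fin 3) ℂ) ^ m ∈ I)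
    (hnot : (X 0 : MvPolynomial (Fin 3) ℂ) ^ (m - 1) ∉ I) : tangentDim I ≤ N := by
  obtain ⟨H, P, h, hH, hN, hP⟩ := exists_isCovered_of_forallTables hm hcheck hI hB hfin hmem hnot
  exact (h.tangentDim_le_of_isCovered hH hP).trans hN

lemma IsMonomialIdeal.exists_hom {I : Ideal (MvPolynomial (Fin 3) ℂ)} (hI : IsMonomialIdeal I)
    (g : (Fin 3 →₀ ℕ) → MvPolynomial (Fin 3) ℂ ⧸ I)
    (hg : ∀ d, monomial d (1 : ℂ) ∈ I → ∀ i : Fin 3,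
      (X i : MvPolynomial (Fin 3) ℂ) • g d = g (d + Finsupp.single i 1)) :
    ∃ φ : I →ₗ[MvPolynomial (Fin 3) ℂ] (MvPolynomial (Fin 3) ℂ ⧸ I),
      ∀ d (hd : monomial d (1 : ℂ) ∈ I), φ ⟨monomial d 1, hd⟩ = g d := by
  let Φ : MvPolynomial (Fin 3) ℂ →ₗ[ℂ] (MvPolynomial (Fin 3) ℂ ⧸ I) :=
    (basisMonomials (Fin 3) ℂ).constr ℂ g
  have hΦ : ∀ d, Φ (monomial d 1) = g d := fun d => by
    have := (basisMonomials (Fin 3) ℂ).constr_basis ℂ g d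
    rwa [coe_basisMonomials] at this
  have hX : ∀ (i : Fin 3) (f), f ∈ I → Φ (X i * f) = (X i : MvPolynomial (Fin 3) ℂ) • Φ f := by
    intro i f hf
    have hmon : ∀ d (c : ℂ), (monomial d c : MvPolynomial (Fin 3) ℂ) = c • monomial d 1 :=
      fun d c => by rw [smul_monomial, smul_eq_mul, mul_one]
    rw [f.as_sum, Finset.mul_sum, map_sum, map_sum, Finset.smul_sum]
    refine Finset.sum_congr rfl fun d hd => ?_
    rw [hmon, mul_smul_comm, map_smul, map_smul, smul_comm, hΦ, hg d (hI f hf d hd), X,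
      monomial_mul, mul_one, hΦ, add_comm]
  have hR : ∀ r f : MvPolynomial (Fin 3) ℂ, f ∈ I → Φ (r * f) = r • Φ f := by
    intro r f hf
    induction r using MvPolynomial.induction_on with
    | C c => rw [C_mul', map_smul, ← algebraMap_smul (MvPolynomial (Fin 3) ℂ) c (Φ f)]; rfl
    | add p q hp hq => rw [add_mul, map_add, hp, hq, add_smul]
    | mul_X p i hp =>
      rw [mul_comm p, mul_assoc, hX i _ (I.mul_mem_left p hf), hp, smul_smul]
  exact ⟨{ toFun := fun f => Φ f.1
           map_add' := fun f f' => map_add Φ f.1 f'.1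
           map_smul' := fun r f => hR r f.1 f.2 }, fun d _ => hΦ d⟩

lemma HasHeights.exists_homCoeff_eq {I : Ideal (MvPolynomial (Fin 3) ℂ)} {H : ℕ → ℕ → ℕ}
    (h : HasHeights I H) (hH : IsBorelStaircase H)
    (hfin : 0 < Module.finrank ℂ (MvPolynomial (Fin 3) ℂ ⧸ I))
    {F : ℕ → ℕ → ℕ → ℕ → ℕ → ℂ} (hF : IsTangentFamily H F) :
    ∃ φ, ∀ a b p q r, r < H p q → h.homCoeff φ a b p q r = F a b p q r := by
  classical
  have := Module.finite_of_finrank_pos hfin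
  have : Finite {d : Fin 3 →₀ ℕ // monomial d (1 : ℂ) ∉ I} :=
    Module.Finite.finite_basis h.isMonomial.quotBasis
  have := Fintype.ofFinite {d : Fin 3 →₀ ℕ // monomial d (1 : ℂ) ∉ I}
  let f : ℕ → ℕ → MvPolynomial (Fin 3) ℂ ⧸ I := fun a b =>
    ∑ d : {d : Fin 3 →₀ ℕ // monomial d (1 : ℂ) ∉ I},
      F a b (d.1 0) (d.1 1) (d.1 2) • Ideal.Quotient.mk I (monomial d.1 (1 : ℂ))
  have hf : ∀ a b p q r, r < H p q → quotCoeff I (expo p q r) (f a b) = F a b p q r := by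
    intro a b p q r hr
    have hd := (h.not_mem_iff p q r).mpr hr
    simp only [f, map_sum, map_smul, h.isMonomial.quotCoeff_mk hd, coeff_monomial, smul_eq_mul,
      mul_ite, mul_one, mul_zero]
    rw [Finset.sum_eq_single ⟨expo p q r, hd⟩]
    · simp
    · exact fun e _ hne => if_neg fun h' => hne (Subtype.ext h')
    · exact fun h' => absurd (Finset.mem_univ _) h'
  have hsmul : ∀ a b c a' b' c' (q : MvPolynomial (Fin 3) ℂ ⧸ I),
      monomial (expo a b c) (1 : ℂ) • monomial (expo a' b' c') (1 : ℂ) • q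
        = monomial (expo (a + a') (b + b') (c + c')) (1 : ℂ) • q := fun a b c a' b' c' q => by
    rw [smul_smul, monomial_mul, expo_add_expo, mul_one]
  have hx : ∀ a b, monomial (expo 1 0 0) (1 : ℂ) • f a b
      = monomial (expo 0 0 (H a b - H (a + 1) b)) (1 : ℂ) • f (a + 1) b := by
    intro a b
    refine sub_eq_zero.mp (h.isMonomial.eq_zero_of_quotCoeff fun d hd => ?_)
    rw [← expo_eta d] at hd ⊢
    have hr := (h.not_mem_iff _ _ _).mp hd
    rw [map_sub, sub_eq_zero, h.isMonomial.quotCoeff_monomial_smul hd,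
      h.isMonomial.quotCoeff_monomial_smul hd]
    simp only [expo_le_expo, zero_le, expo_sub_expo, tsub_zero, true_and, and_true]
    have hrel := hF.rel_x a b _ _ _ hr
    rw [hf _ _ _ _ _ (hr.trans_le (hH.antitone_x _ (Nat.sub_le _ _))),
      hf _ _ _ _ _ ((Nat.sub_le _ _).trans_lt hr)]
    simpa only [← not_lt, ite_not, Nat.lt_one_iff] using hrel
  have hy : ∀ a b, monomial (expo 0 1 0) (1 : ℂ) • f a b
      = monomial (expo 0 0 (H a b - H a (b + 1))) (1 : ℂ) • f a (b + 1) := by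
    intro a b
    refine sub_eq_zero.mp (h.isMonomial.eq_zero_of_quotCoeff fun d hd => ?_)
    rw [← expo_eta d] at hd ⊢
    have hr := (h.not_mem_iff _ _ _).mp hd
    rw [map_sub, sub_eq_zero, h.isMonomial.quotCoeff_monomial_smul hd,
      h.isMonomial.quotCoeff_monomial_smul hd]
    simp only [expo_le_expo, zero_le, expo_sub_expo, tsub_zero, true_and, and_true]
    have hrel := hF.rel_y a b _ _ _ hr
    rw [hf _ _ _ _ _ (hr.trans_le (hH.antitone_y _ (Nat.sub_le _ _))),
      hf _ _ _ _ _ ((Nat.sub_le _ _).trans_lt hr)]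
    simpa only [← not_lt, ite_not, Nat.lt_one_iff] using hrel
  obtain ⟨φ, hφ⟩ := h.isMonomial.exists_hom
    (fun d => monomial (expo 0 0 (d 2 - H (d 0) (d 1))) (1 : ℂ) • f (d 0) (d 1)) (by
      intro d hd i
      rw [← expo_eta d] at hd ⊢
      generalize d 0 = a at *
      generalize d 1 = b at *
      generalize d 2 = c at *
      have hc := (h.mem_iff _ _ _).mp hd
      fin_cases i
      · have := hH.le_of_x a b
        simp only [X, Fin.zero_eta, single_zero_eq_expo, expo_add_expo, expo_zero, expo_one,
          expo_two]
        rw [smul_comm, hx, hsmul]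
        simp only [add_zero]
        rw [show c - H a b + (H a b - H (a + 1) b) = c - H (a + 1) b by omega]
      · have := hH.le_of_y a b
        simp only [X, Fin.mk_one, single_one_eq_expo, expo_add_expo, expo_zero, expo_one,
          expo_two]
        rw [smul_comm, hy, hsmul]
        simp only [add_zero]
        rw [show c - H a b + (H a b - H a (b + 1)) = c - H a (b + 1) by omega]
      · simp only [X, Fin.reduceFinMk, single_two_eq_expo, expo_add_expo, expo_zero, expo_one,
          expo_two]
        rw [hsmul]
        simp only [add_zero]
        rw [show 1 + (c - H a b) = c + 1 - H a b by omega])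
  refine ⟨φ, fun a b p q r hr => ?_⟩
  rw [homCoeff, gen, hφ]
  simp only [expo_zero, expo_one, expo_two, tsub_self]
  rw [h.isMonomial.quotCoeff_monomial_smul ((h.not_mem_iff _ _ _).mpr hr), expo_sub_expo,
    if_pos (expo_le_expo.mpr ⟨Nat.zero_le _, Nat.zero_le _, Nat.zero_le _⟩)]
  exact hf a b p q r hr

/-- If the indicator functions of the nonzero labels are tangent families, then the number of these
labels is a lower bound for the dimension of the tangent space. -/
lemma HasHeights.card_le_tangentDim {I : Ideal (MvPolynomial (Fin 3) ℂ)} {H : ℕ → ℕ → ℕ}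
    (h : HasHeights I H) (hH : IsBorelStaircase H)
    (hfin : 0 < Module.finrank ℂ (MvPolynomial (Fin 3) ℂ ⧸ I))
    [Module.Finite ℂ (I →ₗ[MvPolynomial (Fin 3) ℂ] (MvPolynomial (Fin 3) ℂ ⧸ I))]
    {L : ℕ → ℕ → ℕ → ℕ → ℕ → ℕ}
    (hL : ∀ u, u ≠ 0 → IsTangentFamily H fun a b p q r => if L a b p q r = u then 1 else 0)
    {U : Finset ℕ} (hU : ∀ u ∈ U, u ≠ 0 ∧ ∃ a b p q r, r < H p q ∧ L a b p q r = u) :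
    U.card ≤ tangentDim I := by
  choose φ hφ using fun u : U => h.exists_homCoeff_eq hH hfin (hL u (hU u u.2).1)
  have hli : LinearIndependent ℂ φ := by
    rw [linearIndependent_iff']
    intro s g hg u hu
    obtain ⟨a, b, p, q, r, hr, hLu⟩ := (hU u u.2).2
    have hsum := congrArg (fun ψ => h.homCoeff ψ a b p q r) hg
    simp only [homCoeff, LinearMap.sum_apply, LinearMap.smul_apply, map_sum, map_smul,
      LinearMap.zero_apply, map_zero] at hsum
    rw [Finset.sum_eq_single u] at hsum
    · have h1 := hφ u a b p q r hr
      rw [homCoeff, if_pos hLu] at h1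
      rwa [h1, smul_eq_mul, mul_one] at hsum
    · intro v _ hvu
      have h1 := hφ v a b p q r hr
      rw [homCoeff, if_neg (fun h' => hvu (Subtype.ext (h'.symm.trans hLu)))] at h1
      rw [h1, smul_zero]
    · exact fun h' => absurd hu h'
  simpa [tangentDim] using hli.fintype_card_le_finrank

/-- A sufficient condition, explored up to depth `n`, for the coefficient at the given position to
vanish for every homomorphism. -/
def isForced (H : ℕ → ℕ → ℕ) : ℕ → ℕ → ℕ → ℕ → ℕ → ℕ → Bool
  | 0, _, _, _, _, _ => false
  | n + 1, a, b, p, q, s =>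
    (q == 0 && decide (0 < b) && decide (s + (H a (b - 1) - H a b) < H p q)) ||
    (p == 0 && decide (0 < a) && decide (s + (H (a - 1) b - H a b) < H p q)) ||
    (decide (s < H p (q + 1)) && (decide (s < H a b - H a (b + 1)) ||
      isForced H n a (b + 1) p (q + 1) (s - (H a b - H a (b + 1))))) ||
    (decide (s < H (p + 1) q) && (decide (s < H a b - H (a + 1) b) ||
      isForced H n (a + 1) b (p + 1) q (s - (H a b - H (a + 1) b))))

/-- A numerical code for a position. -/
def code (a b p q s : ℕ) : ℕ := 1 + (s + 8 * (q + 8 * (p + 8 * (b + 8 * a))))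

/-- The code of the position reached by moving to the left, or down if this is not possible,
as often as possible and at most `n` times, or zero if the coefficient there is forced to vanish. -/
def label (H : ℕ → ℕ → ℕ) : ℕ → ℕ → ℕ → ℕ → ℕ → ℕ → ℕ
  | 0, a, b, p, q, s => if isForced H 10 a b p q s then 0 else code a b p q s
  | n + 1, a, b, p, q, s =>
    if 0 < b ∧ s + (H a (b - 1) - H a b) < H p q then
      if q = 0 then 0 else label H n a (b - 1) p (q - 1) (s + (H a (b - 1) - H a b))
    else if 0 < a ∧ s + (H (a - 1) b - H a b) < H p q then
      if p = 0 then 0 else label H n (a - 1) b (p - 1) q (s + (H (a - 1) b - H a b))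
    else if isForced H 10 a b p q s then 0 else code a b p q s

lemma entry_eq_zero {T : List (List ℕ)} {A B a b : ℕ} (hA : T.length ≤ A)
    (hB : ∀ r ∈ T, r.length ≤ B) (h : A ≤ a ∨ B ≤ b) : entry T a b = 0 := by
  rw [entry]
  by_cases ha : a < T.length
  · rw [List.getD_eq_getElem _ _ ha]
    refine List.getD_eq_default _ _ ((hB _ (List.getElem_mem ha)).trans ?_)
    omega
  · rw [List.getD_eq_default _ _ (not_lt.mp ha), List.getD_nil]

lemma IsBorelStaircase.of_lt {H : ℕ → ℕ → ℕ} {A B : ℕ}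
    (hzero : ∀ a b, A ≤ a ∨ B ≤ b → H a b = 0)
    (h : ∀ a < A, ∀ b < B, H a (b + 1) ≤ H a b - 1 ∧ H (a + 1) b ≤ H a b - 1 ∧
      H (a + 1) b ≤ H a (b + 1)) : IsBorelStaircase H := by
  have h' : ∀ a b, H a (b + 1) ≤ H a b - 1 ∧ H (a + 1) b ≤ H a b - 1 ∧
      H (a + 1) b ≤ H a (b + 1) := by
    intro a b
    by_cases hab : a < A ∧ b < B
    · exact h a hab.1 b hab.2
    · rw [hzero a (b + 1) (by omega), hzero (a + 1) b (by omega)]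
      exact ⟨Nat.zero_le _, Nat.zero_le _, le_rfl⟩
  exact ⟨fun a b => (h' a b).1, fun a b => (h' a b).2.1, fun a b => (h' a b).2.2⟩

/-- The monomial ideal with a given height function. -/
noncomputable def staircaseIdeal (H : ℕ → ℕ → ℕ) : Ideal (MvPolynomial (Fin 3) ℂ) :=
  Ideal.span ((fun d => monomial d (1 : ℂ)) '' {d | H (d 0) (d 1) ≤ d 2})

lemma IsBorelStaircase.hasHeights {H : ℕ → ℕ → ℕ} (hH : IsBorelStaircase H) :
    HasHeights (staircaseIdeal H) H := by
  have hmem : ∀ f, f ∈ staircaseIdeal H ↔ ∀ d ∈ f.support, H (d 0) (d 1) ≤ d 2 := by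
    intro f
    rw [staircaseIdeal, mem_ideal_span_monomial_image]
    refine forall₂_congr fun d _ => ⟨fun ⟨e, he, hle⟩ => ?_, fun hd => ⟨d, hd, le_rfl⟩⟩
    exact (hH.antitone_x _ (hle 0)).trans ((hH.antitone_y _ (hle 1)).trans (he.trans (hle 2)))
  refine ⟨fun f hf d hd => (hmem _).mpr fun e he => ?_, fun a b c => ?_⟩
  · rw [support_monomial, if_neg one_ne_zero, Finset.mem_singleton] at he
    exact he ▸ (hmem f).mp hf d hd
  · rw [hmem, support_monomial, if_neg one_ne_zero]
    simp

/-- The relations of a tangent family, for labels in place of coefficients. -/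
structure IsLabelling (H : ℕ → ℕ → ℕ) (L : ℕ → ℕ → ℕ → ℕ → ℕ → ℕ) : Prop where
  rel_x : ∀ a b p q r, r < H p q → (if p = 0 then 0 else L a b (p - 1) q r) =
    if r < H a b - H (a + 1) b then 0 else L (a + 1) b p q (r - (H a b - H (a + 1) b))
  rel_y : ∀ a b p q r, r < H p q → (if q = 0 then 0 else L a b p (q - 1) r) =
    if r < H a b - H a (b + 1) then 0 else L a (b + 1) p q (r - (H a b - H a (b + 1)))

lemma IsLabelling.isTangentFamily {H : ℕ → ℕ → ℕ} {L : ℕ → ℕ → ℕ → ℕ → ℕ → ℕ}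
    (hL : IsLabelling H L) {u : ℕ} (hu : u ≠ 0) :
    IsTangentFamily H fun a b p q r => if L a b p q r = u then 1 else 0 := by
  have key : ∀ (P : Prop) [Decidable P] (v : ℕ), (if P then (0 : ℂ) else if v = u then 1 else 0)
      = if (if P then 0 else v) = u then 1 else 0 := fun P _ v => by
    split_ifs <;> simp_all
  refine ⟨fun a b p q r hr => ?_, fun a b p q r hr => ?_⟩
  · rw [key, key, hL.rel_x a b p q r hr]
  · rw [key, key, hL.rel_y a b p q r hr]

/-- Extension of labels from the generators with `a ≤ A` and `b ≤ B` to all generators. -/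
def extendLabel (A B : ℕ) (L : ℕ → ℕ → ℕ → ℕ → ℕ → ℕ) (a b p q r : ℕ) : ℕ :=
  if p < a - A ∨ q < b - B then 0 else L (min a A) (min b B) (p - (a - A)) (q - (b - B)) r

lemma extendLabel_of_le {A B a b : ℕ} (ha : a ≤ A) (hb : b ≤ B)
    (L : ℕ → ℕ → ℕ → ℕ → ℕ → ℕ) (p q r : ℕ) :
    extendLabel A B L a b p q r = L a b p q r := by
  simp [extendLabel, Nat.sub_eq_zero_of_le ha, Nat.sub_eq_zero_of_le hb, min_eq_left ha,
    min_eq_left hb]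

lemma isLabelling_extendLabel {H : ℕ → ℕ → ℕ} {A B : ℕ} {L : ℕ → ℕ → ℕ → ℕ → ℕ → ℕ}
    (hH : IsBorelStaircase H) (hzero : ∀ a b, A ≤ a ∨ B ≤ b → H a b = 0)
    (hx : ∀ a < A, ∀ b < B + 1, ∀ p < A, ∀ q < B, ∀ r < H p q,
      (if p = 0 then 0 else L a b (p - 1) q r) =
        if r < H a b - H (a + 1) b then 0 else L (a + 1) b p q (r - (H a b - H (a + 1) b)))
    (hy : ∀ a < A + 1, ∀ b < B, ∀ p < A, ∀ q < B, ∀ r < H p q,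
      (if q = 0 then 0 else L a b p (q - 1) r) =
        if r < H a b - H a (b + 1) then 0 else L a (b + 1) p q (r - (H a b - H a (b + 1)))) :
    IsLabelling H (extendLabel A B L) := by
  have hlt : ∀ {p q r}, r < H p q → p < A ∧ q < B := fun {p q r} hr => by
    by_contra hpq
    rw [hzero p q (by omega)] at hr
    omega
  refine ⟨fun a b p q r hr => ?_, fun a b p q r hr => ?_⟩
  · have hmin : ∀ a, H a b = H a (min b B) := fun a => by
      rcases le_total b B with hb | hb
      · rw [min_eq_left hb]
      · rw [min_eq_right hb, hzero a b (Or.inr hb), hzero a B (Or.inr le_rfl)]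
    obtain ⟨hp, hq⟩ := hlt hr
    rcases lt_or_ge a A with ha | ha
    · have hr' : r < H p (q - (b - B)) := hr.trans_le (hH.antitone_y p (Nat.sub_le _ _))
      have := hx a ha (min b B) (by omega) p hp _ (by omega) r hr'
      rw [← hmin, ← hmin] at this
      simp only [extendLabel, Nat.sub_eq_zero_of_le ha.le, Nat.sub_eq_zero_of_le ha, tsub_zero,
        Nat.not_lt_zero, false_or, min_eq_left ha.le, min_eq_left (Nat.succ_le_of_lt ha)]
      by_cases hqb : q < b - B
      · simp [hqb]
      · simpa only [hqb, if_false] using this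
    · rw [hzero a b (Or.inl ha), hzero (a + 1) b (Or.inl (by omega))]
      simp only [extendLabel, tsub_self, Nat.not_lt_zero, if_false, tsub_zero, min_eq_right ha,
        min_eq_right (ha.trans (Nat.le_succ a))]
      rcases Nat.eq_zero_or_pos p with rfl | hp0
      · rw [if_pos rfl, if_pos (Or.inl (by omega))]
      · rw [if_neg hp0.ne', show p - 1 - (a - A) = p - (a + 1 - A) by omega]
        exact if_congr (or_congr_left (by omega)) rfl rfl
  · have hmin : ∀ b, H a b = H (min a A) b := fun b => by
      rcases le_total a A with ha | ha
      · rw [min_eq_left ha]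
      · rw [min_eq_right ha, hzero a b (Or.inl ha), hzero A b (Or.inl le_rfl)]
    obtain ⟨hp, hq⟩ := hlt hr
    rcases lt_or_ge b B with hb | hb
    · have hr' : r < H (p - (a - A)) q := hr.trans_le (hH.antitone_x q (Nat.sub_le _ _))
      have := hy (min a A) (by omega) b hb _ (by omega) q hq r hr'
      rw [← hmin, ← hmin] at this
      simp only [extendLabel, Nat.sub_eq_zero_of_le hb.le, Nat.sub_eq_zero_of_le hb, tsub_zero,
        Nat.not_lt_zero, or_false, min_eq_left hb.le, min_eq_left (Nat.succ_le_of_lt hb)]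
      by_cases hpa : p < a - A
      · simp [hpa]
      · simpa only [hpa, if_false] using this
    · rw [hzero a b (Or.inr hb), hzero a (b + 1) (Or.inr (by omega))]
      simp only [extendLabel, tsub_self, Nat.not_lt_zero, if_false, tsub_zero, min_eq_right hb,
        min_eq_right (hb.trans (Nat.le_succ b))]
      rcases Nat.eq_zero_or_pos q with rfl | hq0
      · rw [if_pos rfl, if_pos (Or.inr (by omega))]
      · rw [if_neg hq0.ne', show q - 1 - (b - B) = q - (b + 1 - B) by omega]
        exact if_congr (or_congr_right (by omega)) rfl rfl

/-- The labels at the generators with `a ≤ A` and `b ≤ B`. -/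
def labels (H : ℕ → ℕ → ℕ) (A B : ℕ) (L : ℕ → ℕ → ℕ → ℕ → ℕ → ℕ) : List ℕ :=
  (List.range (A + 1)).flatMap fun a => (List.range (B + 1)).flatMap fun b =>
    (List.range A).flatMap fun p => (List.range B).flatMap fun q =>
      (List.range (H p q)).map fun r => L a b p q r

lemma exists_of_mem_labels {H : ℕ → ℕ → ℕ} {A B u : ℕ} {L : ℕ → ℕ → ℕ → ℕ → ℕ → ℕ}
    (hu : u ∈ labels H A B L) :
    ∃ a b p q r, r < H p q ∧ extendLabel A B L a b p q r = u := by
  simp only [labels, List.mem_flatMap, List.mem_map, List.mem_range, Nat.lt_succ_iff] at hu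
  obtain ⟨a, ha, b, hb, p, -, q, -, r, hr, rfl⟩ := hu
  exact ⟨a, b, p, q, r, hr, extendLabel_of_le ha hb L p q r⟩

lemma tmaxEq_of_table {T : List (List ℕ)} {m N : ℕ} (hm : 0 < m)
    (hcheck : forallTables m (List.replicate 7 25) 25 (tableCheck N) = true)
    (hlen : T.length ≤ m) (hrow : ∀ r ∈ T, r.length ≤ 5)
    (hstair : ∀ a < m, ∀ b < 5, entry T a (b + 1) ≤ entry T a b - 1 ∧
      entry T (a + 1) b ≤ entry T a b - 1 ∧ entry T (a + 1) b ≤ entry T a (b + 1))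
    (hsum : ∑ a ∈ Finset.range m, ∑ b ∈ Finset.range 5, entry T a b = 25)
    (hnot : entry T (m - 1) 0 ≠ 0)
    (hx : ∀ a < m, ∀ b < 5 + 1, ∀ p < m, ∀ q < 5, ∀ r < entry T p q,
      (if p = 0 then 0 else label (entry T) 9 a b (p - 1) q r) =
        if r < entry T a b - entry T (a + 1) b then 0
        else label (entry T) 9 (a + 1) b p q (r - (entry T a b - entry T (a + 1) b)))
    (hy : ∀ a < m + 1, ∀ b < 5, ∀ p < m, ∀ q < 5, ∀ r < entry T p q,
      (if q = 0 then 0 else label (entry T) 9 a b p (q - 1) r) =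
        if r < entry T a b - entry T a (b + 1) then 0
        else label (entry T) 9 a (b + 1) p q (r - (entry T a b - entry T a (b + 1))))
    (hcard : N ≤ ((labels (entry T) m 5 (label (entry T) 9)).filter (· ≠ 0)).toFinset.card) :
    TmaxEq 25 m N := by
  have hzero : ∀ a b, m ≤ a ∨ 5 ≤ b → entry T a b = 0 := fun a b => entry_eq_zero hlen hrow
  have hH := IsBorelStaircase.of_lt hzero hstair
  have h := hH.hasHeights
  have hfin : Module.finrank ℂ (MvPolynomial (Fin 3) ℂ ⧸ staircaseIdeal (entry T)) = 25 := by
    rw [h.finrank_quotient (fun a b ha => hzero a b (Or.inl ha))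
      (fun a b hb => hzero a b (Or.inr hb)), hsum]
  have hmem : (X 0 : MvPolynomial (Fin 3) ℂ) ^ m ∈ staircaseIdeal (entry T) :=
    (h.X_pow_mem_iff m).mpr (hzero m 0 (Or.inl le_rfl))
  have hnmem : (X 0 : MvPolynomial (Fin 3) ℂ) ^ (m - 1) ∉ staircaseIdeal (entry T) :=
    fun h' => hnot ((h.X_pow_mem_iff _).mp h')
  have hB := hH.isBorelFixed h
  refine ⟨⟨_, h.isMonomial, hB, hfin, hmem, hnmem, le_antisymm ?_ ?_⟩, ?_⟩
  · obtain ⟨H, P, h', hH', -, hP⟩ :=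
      exists_isCovered_of_forallTables hm hcheck h.isMonomial hB hfin hmem hnmem
    have := h'.finite_hom_of_isCovered hH' hP
    refine hcard.trans (h.card_le_tangentDim hH (by omega) (L := extendLabel m 5 _)
      (fun u => (isLabelling_extendLabel hH hzero hx hy).isTangentFamily) fun u hu => ?_)
    rw [List.mem_toFinset, List.mem_filter] at hu
    exact ⟨by simpa using hu.2, exists_of_mem_labels hu.1⟩
  · exact tangentDim_le_of_forallTables hm hcheck h.isMonomial hB hfin hmem hnmem
  · rintro _ ⟨I, hI, hBI, hfI, hmI, hnI, rfl⟩
    exact tangentDim_le_of_forallTables hm hcheck hI hBI hfI hmI hnI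

lemma tmaxEq_two : TmaxEq 25 2 123 := by
  refine tmaxEq_of_table (T := [[5, 4, 3, 2, 1], [4, 3, 2, 1]]) ?_ ?_ ?_ ?_ ?_ ?_ ?_ ?_ ?_ ?_ <;>
    decide +kernel

lemma tmaxEq_three : TmaxEq 25 3 151 := by
  refine tmaxEq_of_table (T := [[5, 4, 3, 2, 1], [4, 2, 1], [2, 1]])
    ?_ ?_ ?_ ?_ ?_ ?_ ?_ ?_ ?_ ?_ <;>
    decide +kernel

lemma tmaxEq_four : TmaxEq 25 4 177 := by
  refine tmaxEq_of_table (T := [[5, 4, 3, 2, 1], [3, 2, 1], [2, 1], [1]])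
    ?_ ?_ ?_ ?_ ?_ ?_ ?_ ?_ ?_ ?_ <;>
    decide +kernel

lemma TmaxEq.le_of_one {T : ℕ} (h : TmaxEq 25 1 T) : T ≤ 75 := by
  obtain ⟨I, hI, hB, hfin, hmem, hnot, rfl⟩ := h.1
  exact tangentDim_le_of_forallTables one_pos (by decide +kernel) hI hB hfin hmem hnot

theorem Tmax_monotonicity_l25 :
    TmaxEq 25 2 123 ∧
    TmaxEq 25 3 151 ∧
    TmaxEq 25 4 177 ∧
    (∀ T1 T2 T3 T4 : ℕ, TmaxEq 25 1 T1 → TmaxEq 25 2 T2 → TmaxEq 25 3 T3 → TmaxEq 25 4 T4 →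
      T1 < T2 ∧ T2 < T3 ∧ T3 < T4) := by
  refine ⟨tmaxEq_two, tmaxEq_three, tmaxEq_four, fun T1 T2 T3 T4 h1 h2 h3 h4 => ?_⟩
  have := h1.le_of_one
  have := h2.unique tmaxEq_two
  have := h3.unique tmaxEq_three
  have := h4.unique tmaxEq_four
  omega
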